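/- arXiv:1712.05253 — 4 statements merged into one kernel-verified Lean document; each statement's English description precedes it below -/
import Mathlib

section
/- Let 1<s, 0≤δ<1, and let a∈𝒢^s(ℝ) be nonnegative. Then there exist A>0 and C>0, independent of μ∈(0,1], such that for all k,l∈ℕ, all x,ξ∈ℝ and all 0<μ≤1: |∂_x^{k}∂_ξ^{l}φ(x,ξ)| ≤ C·A^{k+l}·(k+l)!·(1+(k+l)^{s-1}⟨ξ⟩_μ^{-δ})^{k+l}·φ(x,ξ)·⟨ξ⟩_μ^{-l+δk}. -/
open scoped ContDiff

open Set

/-- `⟨ξ⟩_μ = (μ⁻² + ξ²)^(1/2)` -/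
noncomputable def br (μ ξ : ℝ) : ℝ := Real.sqrt (μ⁻¹ ^ 2 + ξ ^ 2)

/-- `φ(x,ξ) = a(x) + ⟨ξ⟩_μ^(-2δ)` -/
noncomputable def phi (a : ℝ → ℝ) (δ μ x ξ : ℝ) : ℝ := a x + br μ ξ ^ (-(2*δ))

/-- Gevrey class `𝒢^s(ℝ)` -/
def Gevrey (s : ℝ) (a : ℝ → ℝ) : Prop :=
  ContDiff ℝ ∞ a ∧ ∃ C₀ A₀ : ℝ, 0 < C₀ ∧ 0 < A₀ ∧
    ∀ (x : ℝ) (k : ℕ), |iteratedDeriv k a x| ≤ C₀ * A₀ ^ k * (k.factorial : ℝ) ^ s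

/-- `∂_x^k ∂_ξ^l f(x,ξ)` -/
noncomputable def pdXxi (k l : ℕ) (f : ℝ → ℝ → ℝ) (x ξ : ℝ) : ℝ :=
  iteratedDeriv k (fun x' => iteratedDeriv l (f x') ξ) x

lemma aux_br_sq (μ ξ : ℝ) : br μ ξ ^ 2 = μ⁻¹ ^ 2 + ξ ^ 2 := by
  unfold br; exact Real.sq_sqrt (by positivity)

lemma aux_br_ge (μ ξ : ℝ) (h0 : 0 < μ) (h1 : μ ≤ 1) : 1 ≤ br μ ξ := by
  unfold br
  rw [Real.one_le_sqrt]
  have : 1 ≤ μ⁻¹ := (one_le_inv₀ h0).2 h1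
  nlinarith [sq_nonneg ξ]

lemma aux_br_abs (μ ξ : ℝ) : |ξ| ≤ br μ ξ := by
  unfold br
  exact Real.abs_le_sqrt (by nlinarith [sq_nonneg μ⁻¹])

lemma aux_eq (μ δ : ℝ) : (fun ξ => br μ ξ ^ (-(2*δ))) =
    fun ξ => (μ⁻¹ ^ 2 + ξ ^ 2) ^ (-δ) := by
  funext ξ
  unfold br
  rw [Real.sqrt_eq_rpow, ← Real.rpow_mul (by positivity)]
  congr 1; ring

lemma aux_smooth (μ δ : ℝ) (h0 : 0 < μ) : ContDiff ℝ ∞ (fun ξ => br μ ξ ^ (-(2*δ))) := by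
  rw [aux_eq]
  apply ContDiff.rpow_const_of_ne
  · fun_prop
  · intro x; positivity

lemma aux_hasDeriv (g : ℝ → ℝ) (hg : ContDiff ℝ ∞ g) (n : ℕ) (ξ : ℝ) :
    HasDerivAt (iteratedDeriv n g) (iteratedDeriv (n+1) g ξ) ξ := by
  rw [iteratedDeriv_succ]
  exact (hg.differentiable_iteratedDeriv n (by exact_mod_cast WithTop.coe_lt_top _) ξ).hasDerivAt

lemma aux_rec0 (μ δ ξ : ℝ) (h0 : 0 < μ) (g : ℝ → ℝ) (hg : g = fun ξ => br μ ξ ^ (-(2*δ))) :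
    (μ⁻¹ ^ 2 + ξ ^ 2) * iteratedDeriv 1 g ξ + 2 * δ * ξ * iteratedDeriv 0 g ξ = 0 := by
  rw [iteratedDeriv_one, iteratedDeriv_zero, hg, aux_eq]
  have hW : 0 < μ⁻¹ ^ 2 + ξ ^ 2 := by positivity
  have h1 : HasDerivAt (fun ξ : ℝ => μ⁻¹ ^ 2 + ξ ^ 2) (2 * ξ) ξ := by
    simpa using (hasDerivAt_pow 2 ξ).const_add (μ⁻¹ ^ 2)
  have h2 := h1.rpow_const (p := -δ) (Or.inl hW.ne')
  rw [h2.deriv, Real.rpow_sub_one hW.ne']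
  field_simp
  ring

lemma aux_rec (μ δ : ℝ) (h0 : 0 < μ) (g : ℝ → ℝ) (hg : g = fun ξ => br μ ξ ^ (-(2*δ)))
    (n : ℕ) : ∀ ξ : ℝ,
    (μ⁻¹ ^ 2 + ξ ^ 2) * iteratedDeriv (n+2) g ξ + (2*((n:ℝ)+1)+2*δ) * ξ * iteratedDeriv (n+1) g ξ
      + ((n:ℝ)+1)*(n+2*δ) * iteratedDeriv n g ξ = 0 := by
  have hs : ContDiff ℝ ∞ g := hg ▸ aux_smooth μ δ h0
  have h1 : ∀ ξ : ℝ, HasDerivAt (fun ξ : ℝ => μ⁻¹ ^ 2 + ξ ^ 2) (2 * ξ) ξ := fun ξ => by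
    simpa using (hasDerivAt_pow 2 ξ).const_add (μ⁻¹ ^ 2)
  have h2 : ∀ (c ξ : ℝ), HasDerivAt (fun ξ : ℝ => c * ξ) c ξ := fun c ξ => by
    simpa using (hasDerivAt_id ξ).const_mul c
  induction n with
  | zero =>
    intro ξ
    have h := ((h1 ξ).mul (aux_hasDeriv g hs 1 ξ)).add ((h2 (2*δ) ξ).mul (aux_hasDeriv g hs 0 ξ))
    have hz : ((fun ξ : ℝ => μ⁻¹ ^ 2 + ξ ^ 2) * iteratedDeriv 1 g +
        (fun ξ : ℝ => 2*δ * ξ) * iteratedDeriv 0 g) = fun _ => (0:ℝ) := by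
      funext ξ; exact aux_rec0 μ δ ξ h0 g hg
    rw [hz] at h
    have := h.unique (hasDerivAt_const ξ (0:ℝ))
    norm_num at this ⊢
    linarith
  | succ n ih =>
    intro ξ
    have h := (((h1 ξ).mul (aux_hasDeriv g hs (n+2) ξ)).add
      ((h2 (2*((n:ℝ)+1)+2*δ) ξ).mul (aux_hasDeriv g hs (n+1) ξ))).add
      ((aux_hasDeriv g hs n ξ).const_mul (((n:ℝ)+1)*(n+2*δ)))
    have hz : ((fun ξ : ℝ => μ⁻¹ ^ 2 + ξ ^ 2) * iteratedDeriv (n+2) g +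
        (fun ξ : ℝ => (2*((n:ℝ)+1)+2*δ) * ξ) * iteratedDeriv (n+1) g +
        fun ξ => ((n:ℝ)+1)*(n+2*δ) * iteratedDeriv n g ξ) = fun _ => (0:ℝ) := by
      funext ξ; exact ih ξ
    rw [hz] at h
    have := h.unique (hasDerivAt_const ξ (0:ℝ))
    push_cast
    rw [show n + 1 + 2 = n + 2 + 1 from rfl, show n + 1 + 1 = n + 2 from rfl]
    rw [show n + 1 + 1 = n + 2 from rfl] at this
    linear_combination this

lemma aux_bound (μ δ ξ : ℝ) (h0 : 0 < μ) (h1 : μ ≤ 1) (hδ0 : 0 ≤ δ) (hδ1 : δ < 1) (g : ℝ → ℝ)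
    (hg : g = fun ξ => br μ ξ ^ (-(2*δ))) (n : ℕ) :
    |iteratedDeriv n g ξ| * br μ ξ ^ n ≤ 3 ^ n * n.factorial * br μ ξ ^ (-(2*δ)) := by
  have hw1 := aux_br_ge μ ξ h0 h1
  have hξ := aux_br_abs μ ξ
  have hsq := aux_br_sq μ ξ
  have r0 := aux_rec0 μ δ ξ h0 g hg
  have r := fun n => aux_rec μ δ h0 g hg n ξ
  rw [← hsq] at r0
  simp only [← hsq] at r
  have g0 : iteratedDeriv 0 g ξ = br μ ξ ^ (-(2*δ)) := by rw [iteratedDeriv_zero, hg]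
  generalize br μ ξ = w at *
  have hw : 0 < w := by linarith
  set G := w ^ (-(2*δ)) with hG
  have hGp : 0 < G := by positivity
  -- strong two-step induction
  have key : ∀ n : ℕ, |iteratedDeriv n g ξ| * w ^ n ≤ 3 ^ n * n.factorial * G ∧
      |iteratedDeriv (n+1) g ξ| * w ^ (n+1) ≤ 3 ^ (n+1) * (n+1).factorial * G := by
    intro n
    induction n with
    | zero =>
      refine ⟨by simp [-iteratedDeriv_zero, g0, abs_of_pos hGp], ?_⟩
      have e : w ^ 2 * |iteratedDeriv 1 g ξ| = 2 * δ * |ξ| * G := by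
        have : w ^ 2 * iteratedDeriv 1 g ξ = - (2 * δ * ξ * G) := by rw [g0] at r0; linarith
        rw [← abs_of_pos (pow_pos hw 2), ← abs_mul, this, abs_neg, abs_mul, abs_mul, abs_mul,
          abs_of_pos hGp, abs_of_nonneg hδ0]; norm_num
      have : w * (|iteratedDeriv 1 g ξ| * w) ≤ w * (3 * G) := by
        calc w * (|iteratedDeriv 1 g ξ| * w) = 2 * δ * |ξ| * G := by rw [← e]; ring
          _ ≤ 2 * 1 * w * G := by gcongr
          _ ≤ w * (3 * G) := by nlinarith [mul_pos hw hGp]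
      have := le_of_mul_le_mul_left this hw
      simpa using this
    | succ n ih =>
      obtain ⟨ih0, ih1⟩ := ih
      refine ⟨ih1, ?_⟩
      have e : w ^ 2 * |iteratedDeriv (n+2) g ξ| ≤
          (2*((n:ℝ)+1)+2*δ) * |ξ| * |iteratedDeriv (n+1) g ξ|
            + ((n:ℝ)+1)*(n+2*δ) * |iteratedDeriv n g ξ| := by
        have : w ^ 2 * iteratedDeriv (n+2) g ξ = -((2*((n:ℝ)+1)+2*δ) * ξ * iteratedDeriv (n+1) g ξ
            + ((n:ℝ)+1)*(n+2*δ) * iteratedDeriv n g ξ) := by linarith [r n]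
        calc w ^ 2 * |iteratedDeriv (n+2) g ξ| = |w ^ 2 * iteratedDeriv (n+2) g ξ| := by
              rw [abs_mul, abs_of_pos (pow_pos hw 2)]
          _ ≤ _ := by
            rw [this, abs_neg]
            refine (abs_add_le _ _).trans (le_of_eq ?_)
            rw [abs_mul, abs_mul, abs_mul (((n:ℝ)+1)*(n+2*δ)),
              abs_of_nonneg (by positivity : 0 ≤ 2*((n:ℝ)+1)+2*δ),
              abs_of_nonneg (by positivity : 0 ≤ ((n:ℝ)+1)*(n+2*δ))]
      have hf1 : (((n+1).factorial : ℕ) : ℝ) = (n+1) * n.factorial := by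
        rw [Nat.factorial_succ]; push_cast; ring
      have hf2 : (((n+2).factorial : ℕ) : ℝ) = (n+2) * ((n+1) * n.factorial) := by
        rw [Nat.factorial_succ, ← hf1]; push_cast; ring
      have hF : (0:ℝ) < n.factorial := by positivity
      calc |iteratedDeriv (n+2) g ξ| * w ^ (n+2)
          = (w ^ 2 * |iteratedDeriv (n+2) g ξ|) * w ^ n := by ring
        _ ≤ ((2*((n:ℝ)+1)+2*δ) * |ξ| * |iteratedDeriv (n+1) g ξ|
            + ((n:ℝ)+1)*(n+2*δ) * |iteratedDeriv n g ξ|) * w ^ n := by gcongr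
        _ ≤ ((2*((n:ℝ)+1)+2*1) * w * |iteratedDeriv (n+1) g ξ|
            + ((n:ℝ)+1)*(n+2*1) * |iteratedDeriv n g ξ|) * w ^ n := by gcongr
        _ = (2*(n+2)) * (|iteratedDeriv (n+1) g ξ| * w ^ (n+1))
            + ((n:ℝ)+1)*(n+2) * (|iteratedDeriv n g ξ| * w ^ n) := by ring
        _ ≤ (2*(n+2)) * (3 ^ (n+1) * (n+1).factorial * G)
            + ((n:ℝ)+1)*(n+2) * (3 ^ n * n.factorial * G) := by gcongr
        _ = 7 * (3 ^ n * ((n+2) * ((n+1) * n.factorial)) * G) := by rw [hf1]; ring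
        _ ≤ 9 * (3 ^ n * ((n+2) * ((n+1) * n.factorial)) * G) := by gcongr; norm_num
        _ = 3 ^ (n+2) * (n+2).factorial * G := by rw [hf2]; ring
  exact (key n).1

/-- Glaeser-type inequality. -/
lemma aux_glaeser (a : ℝ → ℝ) (hs : ContDiff ℝ ∞ a) (ha0 : ∀ x, 0 ≤ a x) (M : ℝ)
    (hM : ∀ x, |iteratedDeriv 2 a x| ≤ M) (x t : ℝ) (ht : 0 < t) :
    |deriv a x| * t ≤ a x + M * t ^ 2 := by
  have hM0 : 0 ≤ M := (abs_nonneg _).trans (hM 0)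
  have hd : ∀ y, HasDerivAt a (deriv a y) y := fun y => by
    simpa [iteratedDeriv_one] using aux_hasDeriv a hs 0 y
  have hd1 : ∀ y, HasDerivAt (deriv a) (iteratedDeriv 2 a y) y := fun y => by
    have := aux_hasDeriv a hs 1 y
    rwa [iteratedDeriv_one] at this
  have lip : ∀ y z, |deriv a z - deriv a y| ≤ M * |z - y| := fun y z => by
    have := Convex.norm_image_sub_le_of_norm_hasDerivWithin_le (f := deriv a)
      (f' := iteratedDeriv 2 a) (C := M) (s := univ) (x := y) (y := z)
      (fun w _ => (hd1 w).hasDerivWithinAt) (fun w _ => hM w) convex_univ trivial trivial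
    simpa using this
  have hcont : Continuous a := hs.continuous
  have up : deriv a x * t ≤ a x + M * t ^ 2 := by
    obtain ⟨c, hc, e⟩ := exists_hasDerivAt_eq_slope a (deriv a) (show x - t < x by linarith)
      hcont.continuousOn (fun y _ => hd y)
    have e' : deriv a c * t = a x - a (x - t) := by
      rw [e]; rw [div_mul_eq_mul_div, div_eq_iff (by linarith)]; ring
    have l1 := lip c x
    rw [abs_of_pos (by linarith [hc.2] : 0 < x - c)] at l1
    have l2 := (abs_le.1 l1).2
    have : M * (x - c) ≤ M * t := by gcongr; linarith [hc.1]
    nlinarith [ha0 (x - t)]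
  have dn : -deriv a x * t ≤ a x + M * t ^ 2 := by
    obtain ⟨c, hc, e⟩ := exists_hasDerivAt_eq_slope a (deriv a) (show x < x + t by linarith)
      hcont.continuousOn (fun y _ => hd y)
    have e' : deriv a c * t = a (x + t) - a x := by
      rw [e]; rw [div_mul_eq_mul_div, div_eq_iff (by linarith)]; ring
    have l1 := lip x c
    rw [abs_of_pos (by linarith [hc.1] : 0 < c - x)] at l1
    have l2 := (abs_le.1 l1).2
    have : M * (c - x) ≤ M * t := by gcongr; linarith [hc.2]
    nlinarith [ha0 (x + t)]
  rcases abs_choice (deriv a x) with h | h <;> rw [h] <;> assumption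

lemma aux_fact (s : ℝ) (hs : 1 < s) (n : ℕ) (t : ℝ) (ht : 0 < t) :
    (((n+2).factorial : ℕ) : ℝ) ^ (s-1) * t ^ n ≤
      Real.exp (2*(s-1)) ^ (n+2) * (1 + ((n+2 : ℕ) : ℝ) ^ (s-1) * t) ^ (n+2) := by
  set N : ℝ := ((n+2 : ℕ) : ℝ) with hN
  have hN0 : 0 < N := by rw [hN]; positivity
  set q := N ^ (s-1) with hq
  have hq0 : 0 < q := by positivity
  have h1 : (((n+2).factorial : ℕ) : ℝ) ^ (s-1) ≤ q ^ (n+2) := by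
    calc (((n+2).factorial : ℕ) : ℝ) ^ (s-1) ≤ (N ^ (n+2)) ^ (s-1) := by
          apply Real.rpow_le_rpow (by positivity) _ (by linarith)
          rw [hN]; exact_mod_cast Nat.factorial_le_pow (n+2)
      _ = q ^ (n+2) := by
          rw [hq, ← Real.rpow_natCast, ← Real.rpow_natCast, ← Real.rpow_mul hN0.le,
            ← Real.rpow_mul hN0.le, mul_comm]
  have h2 : q ^ 2 ≤ Real.exp (2*(s-1)) ^ (n+2) := by
    have : N ≤ Real.exp N := by linarith [Real.add_one_le_exp N]
    calc q ^ 2 ≤ (Real.exp N ^ (s-1)) ^ 2 := by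
          rw [hq]; gcongr
      _ = Real.exp (2*(s-1)) ^ (n+2) := by
          rw [← Real.exp_mul, ← Real.exp_nat_mul, ← Real.exp_nat_mul]
          congr 1; rw [hN]; push_cast; ring
  calc (((n+2).factorial : ℕ) : ℝ) ^ (s-1) * t ^ n ≤ q ^ (n+2) * t ^ n := by gcongr
    _ = q ^ 2 * (q * t) ^ n := by ring
    _ ≤ Real.exp (2*(s-1)) ^ (n+2) * (1 + q * t) ^ n := by gcongr; linarith
    _ ≤ Real.exp (2*(s-1)) ^ (n+2) * (1 + q * t) ^ (n+2) := by
        gcongr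
        · nlinarith [mul_pos hq0 ht]
        · omega

theorem stmt5 (s δ : ℝ) (hs : 1 < s) (hδ0 : 0 ≤ δ) (hδ1 : δ < 1)
    (a : ℝ → ℝ) (ha : Gevrey s a) (ha0 : ∀ x, 0 ≤ a x) :
    ∃ A C : ℝ, 0 < A ∧ 0 < C ∧
      ∀ (k l : ℕ) (x ξ μ : ℝ), 0 < μ → μ ≤ 1 →
        |pdXxi k l (phi a δ μ) x ξ| ≤
          C * A ^ (k + l) * ((k + l).factorial : ℝ) *
            (1 + ((k + l : ℕ) : ℝ) ^ (s - 1) * br μ ξ ^ (-δ)) ^ (k + l) *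
            phi a δ μ x ξ * br μ ξ ^ (-(l : ℝ) + δ * (k : ℝ)) := by
  obtain ⟨hsm, C₀, A₀, hC, hA, hG⟩ := ha
  set M := C₀ * A₀ ^ 2 * ((2:ℕ).factorial : ℝ) ^ s with hMdef
  have hM0 : 0 < M := by positivity
  have hE : 0 < Real.exp (2*(s-1)) := Real.exp_pos _
  refine ⟨3 + A₀ * Real.exp (2*(s-1)), 1 + C₀ + M, by positivity, by positivity, ?_⟩
  intro k l x ξ μ h0 h1
  have hw1 := aux_br_ge μ ξ h0 h1
  have hB := fun n => aux_bound μ δ ξ h0 h1 hδ0 hδ1 _ rfl n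
  have hw : 0 < br μ ξ := by linarith
  have hphi : 0 < phi a δ μ x ξ := by
    have : 0 < br μ ξ ^ (-(2*δ)) := by positivity
    unfold phi; linarith [ha0 x]
  set A := 3 + A₀ * Real.exp (2*(s-1)) with hAdef
  have hAE : 0 < A₀ * Real.exp (2*(s-1)) := by positivity
  have hA3 : 3 ≤ A := by linarith
  set C := 1 + C₀ + M with hCdef
  have hC1 : 1 ≤ C := by linarith
  have hbase : 1 ≤ (1 + ((k + l : ℕ) : ℝ) ^ (s - 1) * br μ ξ ^ (-δ)) ^ (k + l) := by
    apply one_le_pow₀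
    have : 0 ≤ ((k + l : ℕ) : ℝ) ^ (s - 1) * br μ ξ ^ (-δ) := by positivity
    linarith
  rcases Nat.eq_zero_or_pos l with hl | hl
  · subst hl
    set t := br μ ξ ^ (-δ) with ht
    have ht0 : 0 < t := by positivity
    have ht2 : br μ ξ ^ (-(2*δ)) = t ^ 2 := by
      rw [ht, ← Real.rpow_natCast, ← Real.rpow_mul hw.le]; congr 1; push_cast; ring
    have htk : br μ ξ ^ (-((0:ℕ):ℝ) + δ * (k:ℝ)) = (t ^ k)⁻¹ := by
      rw [ht, ← Real.rpow_natCast, ← Real.rpow_mul hw.le, ← Real.rpow_neg hw.le]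
      congr 1; push_cast; ring
    have hph : phi a δ μ x ξ = a x + t ^ 2 := by rw [phi, ht2]
    have hax := ha0 x
    rw [htk, ← div_eq_mul_inv, le_div_iff₀ (by positivity), hph]
    rw [hph] at hphi
    simp only [Nat.add_zero] at *
    have hpd : ∀ n, pdXxi (n+1) 0 (phi a δ μ) x ξ = iteratedDeriv (n+1) a x := by
      intro n
      unfold pdXxi phi
      simp only [iteratedDeriv_zero]
      rw [iteratedDeriv_succ', iteratedDeriv_succ']
      congr 1
      funext y
      exact deriv_add_const _
    match k with
    | 0 =>
      have : pdXxi 0 0 (phi a δ μ) x ξ = a x + t ^ 2 := by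
        rw [← hph]; simp [pdXxi]
      rw [this, abs_of_pos hphi]
      simp only [pow_zero, Nat.factorial_zero, Nat.cast_one, mul_one]
      nlinarith
    | 1 =>
      rw [hpd 0, zero_add, iteratedDeriv_one]
      have hg := aux_glaeser a hsm ha0 M (fun y => hG y 2) x t ht0
      have h3 : a x + M * t ^ 2 ≤ C * (a x + t ^ 2) := by
        have : 0 < t ^ 2 := by positivity
        nlinarith
      have h4 : C * 1 * 1 * 1 * (a x + t ^ 2) ≤ C * A ^ 1 * (Nat.factorial 1 : ℝ) *
          (1 + ((1:ℕ):ℝ) ^ (s-1) * t) ^ 1 * (a x + t ^ 2) := by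
        gcongr
        · rw [pow_one]; linarith
        · simp
      rw [pow_one] at *
      linarith
    | n + 2 =>
      rw [hpd (n+1)]
      have hf := aux_fact s hs n t ht0
      set F : ℝ := (((n+2).factorial : ℕ) : ℝ) with hF
      have hFp : 0 < F := by rw [hF]; positivity
      have hFs : F ^ s = F * F ^ (s-1) := by
        rw [Real.rpow_sub_one hFp.ne']; field_simp
      set B := (1 + ((n+2 : ℕ) : ℝ) ^ (s-1) * t) ^ (n+2) with hB'
      have hBp : 0 < B := by linarith
      calc |iteratedDeriv (n+1+1) a x| * t ^ (n+2)
          ≤ (C₀ * A₀ ^ (n+2) * F ^ s) * t ^ (n+2) := by gcongr; exact hG x (n+2)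
        _ = C₀ * A₀ ^ (n+2) * F * (F ^ (s-1) * t ^ n) * t ^ 2 := by rw [hFs]; ring
        _ ≤ C₀ * A₀ ^ (n+2) * F * (Real.exp (2*(s-1)) ^ (n+2) * B) * (a x + t ^ 2) := by
            gcongr; linarith
        _ = C₀ * (A₀ * Real.exp (2*(s-1))) ^ (n+2) * F * B * (a x + t ^ 2) := by
            rw [mul_pow]; ring
        _ ≤ C * A ^ (n+2) * F * B * (a x + t ^ 2) := by
            gcongr
            · linarith
            · linarith
  · rcases Nat.eq_zero_or_pos k with hk | hk
    · subst hk
      have hpd : pdXxi 0 l (phi a δ μ) x ξ =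
          iteratedDeriv l (fun ξ => br μ ξ ^ (-(2*δ))) ξ := by
        obtain ⟨m, rfl⟩ := Nat.exists_eq_add_of_lt hl
        unfold pdXxi phi
        simp only [iteratedDeriv_zero]
        rw [iteratedDeriv_succ', iteratedDeriv_succ']
        congr 1
        funext y
        exact deriv_const_add _
      have hwl : br μ ξ ^ (-(l:ℝ) + δ * ((0:ℕ):ℝ)) = (br μ ξ ^ l)⁻¹ := by
        rw [← Real.rpow_natCast, ← Real.rpow_neg hw.le]; congr 1; push_cast; ring
      rw [hpd, hwl, ← div_eq_mul_inv, le_div_iff₀ (by positivity)]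
      refine (hB l).trans ?_
      simp only [Nat.zero_add] at *
      calc 3 ^ l * (l.factorial : ℝ) * br μ ξ ^ (-(2*δ))
          = 1 * 3 ^ l * (l.factorial : ℝ) * 1 * br μ ξ ^ (-(2*δ)) := by ring
        _ ≤ _ := by
          gcongr
          unfold phi; linarith [ha0 x]
    · have hz : pdXxi k l (phi a δ μ) x ξ = 0 := by
        obtain ⟨m, rfl⟩ := Nat.exists_eq_add_of_lt hl
        obtain ⟨j, rfl⟩ := Nat.exists_eq_add_of_lt hk
        unfold pdXxi phi
        have : (fun x' => iteratedDeriv (0+m+1) (fun ξ => a x' + br μ ξ ^ (-(2*δ))) ξ) =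
            fun _ => iteratedDeriv (0+m+1) (fun ξ => br μ ξ ^ (-(2*δ))) ξ := by
          funext x'
          rw [iteratedDeriv_succ', iteratedDeriv_succ']
          congr 1
          funext y
          exact deriv_const_add _
        rw [this, iteratedDeriv_const]
        simp
      rw [hz, abs_zero]
      positivity
end

section
/- Let T>0, let n≥1 be an integer and 0≤α≤1, and set N=n+α. Then there exists C>0, depending only on n, α and T, such that for every nonnegative f∈C^{n,α}([0,T]) with C^{n,α}-norm at most B, every r>0 and every t∈[0,T]: ∫_0^t |f'(σ)|/(f(σ)+r) dσ ≤ C·B^{1/N}·r^{-1/N}. -/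
open Set

/-- The `C^{n,α}([0,T])` norm:
`Σ_{j=0}^{n} sup_{[0,T]} |f⁽ʲ⁾| + sup_{t≠t'} |f⁽ⁿ⁾(t)−f⁽ⁿ⁾(t')|/|t−t'|^α`,
derivatives taken within `[0,T]`. -/
noncomputable def cnaNorm (n : ℕ) (α T : ℝ) (f : ℝ → ℝ) : ℝ :=
  (∑ j ∈ Finset.range (n + 1),
      ⨆ t : Icc (0:ℝ) T, |iteratedDerivWithin j f (Icc 0 T) (t : ℝ)|)
    + ⨆ q : {q : ℝ × ℝ // q.1 ∈ Icc (0:ℝ) T ∧ q.2 ∈ Icc (0:ℝ) T ∧ q.1 ≠ q.2},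
        |iteratedDerivWithin n f (Icc 0 T) (q : ℝ × ℝ).1 -
            iteratedDerivWithin n f (Icc 0 T) (q : ℝ × ℝ).2| /
          |(q : ℝ × ℝ).1 - (q : ℝ × ℝ).2| ^ α

open Polynomial in
lemma exists_antideriv (Q : ℝ[X]) (n : ℕ) (hQ : Q.natDegree ≤ n) (a c : ℝ) :
    ∃ P : ℝ[X], P.natDegree ≤ n + 1 ∧ derivative P = Q ∧ P.eval a = c := by
  set P0 : ℝ[X] := ∑ i ∈ Finset.range (n + 1), monomial (i + 1) (Q.coeff i / ((i : ℝ) + 1)) with hP0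
  have hd : derivative P0 = Q := by
    rw [hP0, derivative_sum]
    conv_rhs => rw [Q.as_sum_range' (n + 1) (by omega)]
    refine Finset.sum_congr rfl fun i _ => ?_
    rw [derivative_monomial]
    simp only [Nat.add_sub_cancel]
    congr 1
    have : (i : ℝ) + 1 ≠ 0 := by positivity
    push_cast
    field_simp
  have hn : P0.natDegree ≤ n + 1 := by
    refine natDegree_sum_le_of_forall_le _ _ fun i hi => ?_
    refine (natDegree_monomial_le _).trans ?_
    have := Finset.mem_range.1 hi
    omega
  refine ⟨P0 + C (c - P0.eval a), ?_, ?_, ?_⟩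
  · rwa [natDegree_add_C]
  · simp [hd]
  · simp

open Polynomial in
lemma approx_step (T : ℝ) (f g : ℝ → ℝ) (H β : ℝ) (hH : 0 ≤ H) (hβ : 0 ≤ β) (n : ℕ)
    (hf : ∀ x ∈ Icc (0:ℝ) T, HasDerivWithinAt f (g x) (Icc 0 T) x) (a : ℝ) (ha : a ∈ Icc (0:ℝ) T)
    (Q : ℝ[X]) (hQ : Q.natDegree ≤ n)
    (hb : ∀ t ∈ Icc a T, |g t - Q.eval t| ≤ H * (t - a) ^ β) :
    ∃ P : ℝ[X], P.natDegree ≤ n + 1 ∧ derivative P = Q ∧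
      ∀ t ∈ Icc a T, |f t - P.eval t| ≤ H * (t - a) ^ (β + 1) := by
  obtain ⟨P, hP1, hP2, hP3⟩ := exists_antideriv Q n hQ a (f a)
  refine ⟨P, hP1, hP2, fun t ht => ?_⟩
  have key := norm_image_sub_le_of_norm_deriv_le_segment' (f := fun x => f x - P.eval x)
    (f' := fun x => g x - Q.eval x) (a := a) (b := t) (C := H * (t - a) ^ β) ?_ ?_ t
    (right_mem_Icc.2 ht.1)
  · simp only [hP3, sub_self, sub_zero, Real.norm_eq_abs] at key
    rcases eq_or_lt_of_le ht.1 with h | h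
    · subst h
      rw [hP3]
      simp only [sub_self, abs_zero]
      exact mul_nonneg hH (Real.rpow_nonneg le_rfl _)
    · rw [Real.rpow_add_one (by linarith)]
      linarith
  · intro x hx
    have h1 := (hf x ⟨ha.1.trans hx.1, hx.2.trans ht.2⟩).mono
      (Icc_subset_Icc ha.1 ht.2)
    have h2 := (P.hasDerivAt x).hasDerivWithinAt (s := Icc a t)
    rw [hP2] at h2
    exact h1.sub h2
  · intro x hx
    refine (hb x ⟨hx.1, hx.2.le.trans ht.2⟩).trans ?_
    have := hx.1
    have := hx.2
    gcongr

open Polynomial in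
lemma approx (T : ℝ) (hT : 0 < T) (α H : ℝ) (hα : 0 ≤ α) (hH : 0 ≤ H) (a : ℝ)
    (ha : a ∈ Icc (0:ℝ) T) (n : ℕ) : ∀ (g : ℝ → ℝ), ContDiffOn ℝ n g (Icc 0 T) →
    (∀ t ∈ Icc (0:ℝ) T, ∀ t' ∈ Icc (0:ℝ) T,
          |iteratedDerivWithin n g (Icc 0 T) t - iteratedDerivWithin n g (Icc 0 T) t'| ≤
            H * |t - t'| ^ α) →
    ∃ Q : ℝ[X], Q.natDegree ≤ n ∧ ∀ t ∈ Icc a T, |g t - Q.eval t| ≤ H * (t - a) ^ ((n : ℝ) + α) := by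
  induction n with
  | zero =>
    intro g _ h
    refine ⟨C (g a), by simp, fun t ht => ?_⟩
    have := h t ⟨ha.1.trans ht.1, ht.2⟩ a ha
    simp only [iteratedDerivWithin_zero] at this
    rw [abs_of_nonneg (sub_nonneg.2 ht.1)] at this
    simpa using this
  | succ n ih =>
    intro g hg h
    have hu := uniqueDiffOn_Icc hT
    have hg' : ContDiffOn ℝ n (derivWithin g (Icc 0 T)) (Icc 0 T) :=
      hg.derivWithin hu (by push_cast; exact le_rfl)
    rw [iteratedDerivWithin_succ'] at h
    obtain ⟨Q, hQ, hb⟩ := ih _ hg' h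
    obtain ⟨P, hP, -, hPb⟩ := approx_step T g _ H ((n : ℝ) + α) hH (by positivity) n
      (fun x hx => ((hg.differentiableOn (by simp)) x hx).hasDerivWithinAt) a ha Q hQ hb
    refine ⟨P, hP, fun t ht => ?_⟩
    have := hPb t ht
    push_cast
    rwa [show (n : ℝ) + 1 + α = n + α + 1 by ring]

open Polynomial in
lemma poly_mono (P : ℝ[X]) (l : ℝ) (hl : 0 < l) (a b : ℝ) (hab : a ≤ b)
    (h : ∀ x ∈ Ioo a b, (derivative P).eval x ≠ 0) :
    ∫ x in a..b, |(derivative P).eval x| / (1 + (P.eval x / l) ^ 2) ≤ l * Real.pi := by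
  have hpos : ∀ x, 0 < 1 + (P.eval x / l) ^ 2 := fun x => by positivity
  have hc1 : Continuous fun x => (derivative P).eval x / (1 + (P.eval x / l) ^ 2) :=
    (derivative P).continuous.div (by fun_prop) fun x => (hpos x).ne'
  have hc2 : Continuous fun x => |(derivative P).eval x| / (1 + (P.eval x / l) ^ 2) :=
    (derivative P).continuous.abs.div (by fun_prop) fun x => (hpos x).ne'
  have hI : ∫ x in a..b, (derivative P).eval x / (1 + (P.eval x / l) ^ 2) =
      l * Real.arctan (P.eval b / l) - l * Real.arctan (P.eval a / l) := by
    refine intervalIntegral.integral_eq_sub_of_hasDerivAt (f := fun x => l * Real.arctan (P.eval x / l))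
      (fun x _ => ?_) (hc1.intervalIntegrable _ _)
    have := (((P.hasDerivAt x).div_const l).arctan).const_mul l
    refine this.congr_deriv ?_
    have h9 := (hpos x).ne'
    rw [one_div, div_eq_mul_inv (eval x (derivative P)) l, div_eq_mul_inv _ (1 + (eval x P / l) ^ 2)]
    rw [show l * ((1 + (eval x P / l) ^ 2)⁻¹ * (eval x (derivative P) * l⁻¹)) =
      (eval x (derivative P) * (1 + (eval x P / l) ^ 2)⁻¹) * (l * l⁻¹) by ring,
      mul_inv_cancel₀ hl.ne', mul_one]
  have b1 := Real.arctan_lt_pi_div_two (P.eval b / l)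
  have b2 := Real.arctan_lt_pi_div_two (P.eval a / l)
  have b3 := Real.neg_pi_div_two_lt_arctan (P.eval b / l)
  have b4 := Real.neg_pi_div_two_lt_arctan (P.eval a / l)
  have hs : (∀ x ∈ Ioo a b, 0 < (derivative P).eval x) ∨ (∀ x ∈ Ioo a b, (derivative P).eval x < 0) := by
    by_contra hcon
    push Not at hcon
    obtain ⟨⟨x, hx, hx'⟩, y, hy, hy'⟩ := hcon
    obtain ⟨z, hz, hz'⟩ := isPreconnected_Ioo.intermediate_value hx hy
      (derivative P).continuous.continuousOn ⟨hx', hy'⟩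
    exact h z hz hz'
  rcases hs with hs | hs
  · have : ∫ x in a..b, |(derivative P).eval x| / (1 + (P.eval x / l) ^ 2) ≤
        ∫ x in a..b, (derivative P).eval x / (1 + (P.eval x / l) ^ 2) := by
      refine intervalIntegral.integral_mono_on_of_le_Ioo hab (hc2.intervalIntegrable _ _)
        (hc1.intervalIntegrable _ _) fun x hx => ?_
      rw [abs_of_pos (hs x hx)]
    rw [hI] at this
    nlinarith
  · have : ∫ x in a..b, |(derivative P).eval x| / (1 + (P.eval x / l) ^ 2) ≤
        ∫ x in a..b, -((derivative P).eval x / (1 + (P.eval x / l) ^ 2)) := by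
      refine intervalIntegral.integral_mono_on_of_le_Ioo hab (hc2.intervalIntegrable _ _)
        (hc1.neg.intervalIntegrable _ _) fun x hx => ?_
      rw [abs_of_neg (hs x hx), neg_div]
    rw [intervalIntegral.integral_neg, hI] at this
    nlinarith

open Polynomial in
lemma poly_split (P : ℝ[X]) (l : ℝ) (hl : 0 < l) (S : Finset ℝ) : ∀ (a b : ℝ), a ≤ b →
    (∀ x ∈ Ioo a b, (derivative P).eval x = 0 → x ∈ S) →
    ∫ x in a..b, |(derivative P).eval x| / (1 + (P.eval x / l) ^ 2) ≤ l * Real.pi * 2 ^ S.card := by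
  have hpos : ∀ x, 0 < 1 + (P.eval x / l) ^ 2 := fun x => by positivity
  have hc2 : Continuous fun x => |(derivative P).eval x| / (1 + (P.eval x / l) ^ 2) :=
    (derivative P).continuous.abs.div (by fun_prop) fun x => (hpos x).ne'
  have hpi := Real.pi_pos
  induction S using Finset.induction_on with
  | empty =>
    intro a b hab h
    have := poly_mono P l hl a b hab (fun x hx h0 => by simpa using h x hx h0)
    simpa using this
  | insert s S hs ih =>
    intro a b hab h
    rw [Finset.card_insert_of_notMem hs, pow_succ]
    by_cases hsm : s ∈ Ioo a b
    · have h1 := ih a s hsm.1.le fun x hx h0 => by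
        have := h x ⟨hx.1, hx.2.trans hsm.2⟩ h0
        exact (Finset.mem_insert.1 this).resolve_left hx.2.ne
      have h2 := ih s b hsm.2.le fun x hx h0 => by
        have := h x ⟨hsm.1.trans hx.1, hx.2⟩ h0
        exact (Finset.mem_insert.1 this).resolve_left hx.1.ne'
      rw [← intervalIntegral.integral_add_adjacent_intervals (hc2.intervalIntegrable a s)
        (hc2.intervalIntegrable s b)]
      linarith
    · have h1 := ih a b hab fun x hx h0 => by
        refine (Finset.mem_insert.1 (h x hx h0)).resolve_left ?_
        rintro rfl
        exact hsm hx
      have : 0 ≤ l * Real.pi * 2 ^ S.card := by positivity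
      linarith

open Polynomial in
lemma poly_bound (P : ℝ[X]) (n : ℕ) (hn : (derivative P).natDegree ≤ n) (l : ℝ) (hl : 0 < l)
    (a b : ℝ) (hab : a ≤ b) :
    ∫ x in a..b, |(derivative P).eval x| / (1 + (P.eval x / l) ^ 2) ≤ l * Real.pi * 2 ^ n := by
  have hpi := Real.pi_pos
  by_cases h0 : derivative P = 0
  · simp only [h0, eval_zero, abs_zero, zero_div, intervalIntegral.integral_zero]
    positivity
  · refine (poly_split P l hl (derivative P).roots.toFinset a b hab fun x _ hx => ?_).trans ?_
    · simp [h0, hx]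
    · have : (derivative P).roots.toFinset.card ≤ n :=
        ((Multiset.toFinset_card_le _).trans (card_roots' _)).trans hn
      gcongr
      norm_num

lemma cna_facts (T : ℝ) (hT : 0 < T) (n : ℕ) (hn : 1 ≤ n) (α : ℝ)
    (f : ℝ → ℝ) (B : ℝ) (hf : ContDiffOn ℝ n f (Icc 0 T))
    (hH : ∃ H : ℝ, ∀ t ∈ Icc (0:ℝ) T, ∀ t' ∈ Icc (0:ℝ) T,
          |iteratedDerivWithin n f (Icc 0 T) t - iteratedDerivWithin n f (Icc 0 T) t'| ≤
            H * |t - t'| ^ α) (hB : cnaNorm n α T f ≤ B) :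
    0 ≤ B ∧ (∀ t ∈ Icc (0:ℝ) T, |f t| ≤ B) ∧ (∀ t ∈ Icc (0:ℝ) T, |derivWithin f (Icc 0 T) t| ≤ B) ∧
    ∀ t ∈ Icc (0:ℝ) T, ∀ t' ∈ Icc (0:ℝ) T,
          |iteratedDerivWithin n f (Icc 0 T) t - iteratedDerivWithin n f (Icc 0 T) t'| ≤
            B * |t - t'| ^ α := by
  have hu := uniqueDiffOn_Icc hT
  obtain ⟨H, hH⟩ := hH
  set S : ℕ → ℝ := fun j => ⨆ t : Icc (0:ℝ) T, |iteratedDerivWithin j f (Icc 0 T) (t : ℝ)| with hS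
  set Q : ℝ := ⨆ q : {q : ℝ × ℝ // q.1 ∈ Icc (0:ℝ) T ∧ q.2 ∈ Icc (0:ℝ) T ∧ q.1 ≠ q.2},
        |iteratedDerivWithin n f (Icc 0 T) (q : ℝ × ℝ).1 -
            iteratedDerivWithin n f (Icc 0 T) (q : ℝ × ℝ).2| /
          |(q : ℝ × ℝ).1 - (q : ℝ × ℝ).2| ^ α with hQ
  have hB' : (∑ j ∈ Finset.range (n + 1), S j) + Q ≤ B := hB
  have hS0 : ∀ j, 0 ≤ S j := fun j => Real.iSup_nonneg fun _ => abs_nonneg _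
  have hQ0 : 0 ≤ Q := Real.iSup_nonneg fun _ => by positivity
  have hSB : ∀ j ≤ n, S j ≤ B := fun j hj => by
    have := Finset.single_le_sum (f := S) (fun i _ => hS0 i)
      (Finset.mem_range.2 (Nat.lt_succ_of_le hj))
    simp only [Nat.succ_eq_add_one] at this
    linarith
  have hQB : Q ≤ B := by
    have := Finset.sum_nonneg (s := Finset.range (n + 1)) (fun i _ => hS0 i)
    linarith
  have hd : ∀ j ≤ n, ∀ t ∈ Icc (0:ℝ) T, |iteratedDerivWithin j f (Icc 0 T) t| ≤ B := by
    intro j hj t ht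
    refine le_trans ?_ (hSB j hj)
    have hc : ContinuousOn (fun t => |iteratedDerivWithin j f (Icc 0 T) t|) (Icc 0 T) :=
      (hf.continuousOn_iteratedDerivWithin (by exact_mod_cast hj) hu).abs
    have hb := isCompact_Icc.bddAbove_image hc
    refine le_ciSup (f := fun t : Icc (0:ℝ) T => |iteratedDerivWithin j f (Icc 0 T) (t : ℝ)|) ?_ ⟨t, ht⟩
    refine hb.mono ?_
    rintro _ ⟨x, rfl⟩
    exact ⟨x, x.2, rfl⟩
  refine ⟨hQ0.trans hQB, fun t ht => ?_, fun t ht => ?_, fun t ht t' ht' => ?_⟩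
  · simpa using hd 0 (by omega) t ht
  · simpa [iteratedDerivWithin_one] using hd 1 hn t ht
  · by_cases h : t = t'
    · subst h
      simp only [sub_self, abs_zero]
      exact mul_nonneg (hQ0.trans hQB) (Real.rpow_nonneg le_rfl _)
    · have hpos : 0 < |t - t'| ^ α := Real.rpow_pos_of_pos (abs_pos.2 (sub_ne_zero.2 h)) _
      rw [← div_le_iff₀ hpos]
      refine le_trans ?_ hQB
      refine le_ciSup (f := fun q : {q : ℝ × ℝ // q.1 ∈ Icc (0:ℝ) T ∧ q.2 ∈ Icc (0:ℝ) T ∧ q.1 ≠ q.2} =>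
        |iteratedDerivWithin n f (Icc 0 T) (q : ℝ × ℝ).1 -
            iteratedDerivWithin n f (Icc 0 T) (q : ℝ × ℝ).2| /
          |(q : ℝ × ℝ).1 - (q : ℝ × ℝ).2| ^ α) ?_ ⟨(t, t'), ht, ht', h⟩
      refine ⟨H, ?_⟩
      rintro _ ⟨⟨⟨x, y⟩, hx, hy, hxy⟩, rfl⟩
      have hpos : 0 < |x - y| ^ α := Real.rpow_pos_of_pos (abs_pos.2 (sub_ne_zero.2 hxy)) _
      exact (div_le_iff₀ hpos).2 (hH x hx y hy)

open Polynomial in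
lemma interval_bound (T : ℝ) (hT : 0 < T) (m : ℕ) (α : ℝ) (hα : 0 ≤ α)
    (f : ℝ → ℝ) (B : ℝ) (hB : 0 ≤ B) (hf : ContDiffOn ℝ (m + 1 : ℕ) f (Icc 0 T))
    (hH : ∀ t ∈ Icc (0:ℝ) T, ∀ t' ∈ Icc (0:ℝ) T,
      |iteratedDerivWithin (m + 1) f (Icc 0 T) t - iteratedDerivWithin (m + 1) f (Icc 0 T) t'| ≤
            B * |t - t'| ^ α) (l : ℝ) (hl : 0 < l) (a b : ℝ) (ha : 0 ≤ a) (hab : a < b) (hb : b ≤ T)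
    (hs : B * (b - a) ^ ((m : ℝ) + α + 1) ≤ l) :
    ∫ x in a..b, |derivWithin f (Icc 0 T) x| / (1 + (f x / l) ^ 2) ≤
      l * (3 * Real.pi * 2 ^ m + 1) := by
  have hu := uniqueDiffOn_Icc hT
  have hg' : ContDiffOn ℝ m (derivWithin f (Icc 0 T)) (Icc 0 T) :=
    hf.derivWithin hu (by push_cast; exact le_rfl)
  have haT : a ∈ Icc (0:ℝ) T := ⟨ha, hab.le.trans hb⟩
  have hH' := hH
  rw [iteratedDerivWithin_succ'] at hH'
  obtain ⟨Q, hQ, hQb⟩ := approx T hT α B hα hB a haT m _ hg' hH'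
  obtain ⟨P, hP, hPQ, hPb⟩ := approx_step T f _ B ((m : ℝ) + α) hB (by positivity) m
      (fun x hx => ((hf.differentiableOn (by simp)) x hx).hasDerivWithinAt) a haT Q hQ hQb
  have hpos : ∀ x, 0 < 1 + (P.eval x / l) ^ 2 := fun x => by positivity
  have hc2 : Continuous fun x => |(derivative P).eval x| / (1 + (P.eval x / l) ^ 2) :=
    (derivative P).continuous.abs.div (by fun_prop) fun x => (hpos x).ne'
  have hfc : ContinuousOn f (Icc a b) := hf.continuousOn.mono (Icc_subset_Icc ha hb)
  have hDc : ContinuousOn (derivWithin f (Icc 0 T)) (Icc a b) :=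
    hg'.continuousOn.mono (Icc_subset_Icc ha hb)
  have hc1 : ContinuousOn (fun x => |derivWithin f (Icc 0 T) x| / (1 + (f x / l) ^ 2)) (Icc a b) :=
    hDc.abs.div (by fun_prop) fun x _ => by positivity
  set E := B * (b - a) ^ ((m : ℝ) + α) with hE
  have hE0 : 0 ≤ E := mul_nonneg hB (Real.rpow_nonneg (by linarith) _)
  have hEl : E * (b - a) ≤ l := by
    rw [Real.rpow_add_one (by linarith), ← mul_assoc] at hs
    exact hs
  have hmono : ∫ x in a..b, |derivWithin f (Icc 0 T) x| / (1 + (f x / l) ^ 2) ≤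
      ∫ x in a..b, (3 * (|(derivative P).eval x| / (1 + (P.eval x / l) ^ 2)) + E) := by
    refine intervalIntegral.integral_mono_on hab.le
      (ContinuousOn.intervalIntegrable (by rwa [uIcc_of_le hab.le]))
      (Continuous.intervalIntegrable (by fun_prop) _ _) fun x hx => ?_
    have hxT : x ∈ Icc a T := ⟨hx.1, hx.2.trans hb⟩
    have h1 : |derivWithin f (Icc 0 T) x| ≤ |Q.eval x| + E := by
      have h2 := hQb x hxT
      have h3 : B * (x - a) ^ ((m : ℝ) + α) ≤ E := by
        have := hx.1
        have := hx.2
        rw [hE]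
        gcongr
      have := abs_sub_abs_le_abs_sub (derivWithin f (Icc 0 T) x) (Q.eval x)
      linarith
    have h2 : |f x - P.eval x| ≤ l := by
      refine (hPb x hxT).trans (le_trans ?_ hs)
      have := hx.1
      have := hx.2
      gcongr
    have h3 : |f x / l - P.eval x / l| ≤ 1 := by
      rw [← sub_div, abs_div, abs_of_pos hl, div_le_one hl]
      exact h2
    rw [hPQ]
    generalize f x / l = u at h3 ⊢
    generalize P.eval x / l = v at h3 ⊢
    have hu : 0 < 1 + u ^ 2 := by positivity
    have hv : 0 < 1 + v ^ 2 := by positivity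
    have h4 : 1 + v ^ 2 ≤ 3 * (1 + u ^ 2) := by
      obtain ⟨h5, h6⟩ := abs_le.1 h3
      nlinarith [sq_nonneg (2 * u - v)]
    calc |derivWithin f (Icc 0 T) x| / (1 + u ^ 2) ≤ (|Q.eval x| + E) / (1 + u ^ 2) := by gcongr
      _ = |Q.eval x| / (1 + u ^ 2) + E / (1 + u ^ 2) := add_div _ _ _
      _ ≤ 3 * (|Q.eval x| / (1 + v ^ 2)) + E := by
        refine add_le_add ?_ (div_le_self hE0 (by nlinarith))
        rw [← mul_div_assoc, div_le_div_iff₀ hu hv]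
        nlinarith [abs_nonneg (Q.eval x)]
  rw [intervalIntegral.integral_add ((hc2.const_mul 3).intervalIntegrable _ _) (by simp),
    intervalIntegral.integral_const_mul] at hmono
  have := poly_bound P m (by rwa [hPQ]) l hl a b hab.le
  simp only [intervalIntegral.integral_const, smul_eq_mul] at hmono
  linarith

lemma level_bound (T : ℝ) (hT : 0 < T) (m : ℕ) (α : ℝ) (hα : 0 ≤ α)
    (f : ℝ → ℝ) (B : ℝ) (hB : 0 < B) (hf : ContDiffOn ℝ (m + 1 : ℕ) f (Icc 0 T))
    (hH : ∀ t ∈ Icc (0:ℝ) T, ∀ t' ∈ Icc (0:ℝ) T,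
      |iteratedDerivWithin (m + 1) f (Icc 0 T) t - iteratedDerivWithin (m + 1) f (Icc 0 T) t'| ≤
            B * |t - t'| ^ α) (l : ℝ) (hl : 0 < l) (hlB : l ≤ 2 * B) :
    ∫ x in (0:ℝ)..T, |derivWithin f (Icc 0 T) x| / (1 + (f x / l) ^ 2) ≤
      l * ((3 * Real.pi * 2 ^ m + 1) * ((T + 2) * (B / l) ^ (1 / ((m : ℝ) + α + 1)))) := by
  have hu := uniqueDiffOn_Icc hT
  have hg' : ContDiffOn ℝ m (derivWithin f (Icc 0 T)) (Icc 0 T) :=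
    hf.derivWithin hu (by push_cast; exact le_rfl)
  have hfc : ContinuousOn f (Icc 0 T) := hf.continuousOn
  have hDc : ContinuousOn (derivWithin f (Icc 0 T)) (Icc 0 T) := hg'.continuousOn
  have hc1 : ContinuousOn (fun x => |derivWithin f (Icc 0 T) x| / (1 + (f x / l) ^ 2)) (Icc 0 T) :=
    hDc.abs.div (by fun_prop) fun x _ => by positivity
  set N : ℝ := (m : ℝ) + α + 1 with hN
  have hm0 : (0:ℝ) ≤ m := by positivity
  have hN1 : 1 ≤ N := by linarith
  set X : ℝ := (B / l) ^ (1 / N) with hX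
  have hBl : 0 < B / l := by positivity
  have hX0 : 0 < X := Real.rpow_pos_of_pos hBl _
  have hXN : X ^ N = B / l := by
    rw [hX, ← Real.rpow_mul hBl.le, one_div_mul_cancel (by linarith), Real.rpow_one]
  have hX2 : 1 ≤ 2 * X := by
    have h1 : (1/2 : ℝ) ≤ B / l := by rw [div_le_div_iff₀ (by norm_num) hl]; linarith
    have h2 : (1/2 : ℝ) ≤ (1/2 : ℝ) ^ (1 / N) :=
      Real.self_le_rpow_of_le_one (by norm_num) (by norm_num) ((div_le_one (by linarith)).2 hN1)
    have h3 : (1/2 : ℝ) ^ (1 / N) ≤ X := Real.rpow_le_rpow (by norm_num) h1 (by positivity)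
    linarith
  set M : ℕ := ⌈T * X⌉₊ with hM
  have hM1 : T * X ≤ M := Nat.le_ceil _
  have hM2 : (M : ℝ) < T * X + 1 := Nat.ceil_lt_add_one (by positivity)
  have hM0 : (0:ℝ) < M := lt_of_lt_of_le (by positivity) hM1
  have hstep : 0 < T / M := by positivity
  have hpt : ∀ k : ℕ, k ≤ M → (k : ℝ) * (T / M) ≤ T := fun k hk => by
    have : (k : ℝ) ≤ M := by exact_mod_cast hk
    calc (k : ℝ) * (T / M) ≤ M * (T / M) := by gcongr
      _ = T := by field_simp
  have hsm : B * (T / M) ^ N ≤ l := by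
    have h1 : T / M ≤ X⁻¹ := by
      rw [div_le_iff₀ hM0, inv_mul_eq_div, le_div_iff₀ hX0]
      exact hM1
    calc B * (T / M) ^ N ≤ B * (X⁻¹) ^ N := by gcongr
      _ = l := by
        rw [Real.inv_rpow hX0.le, hXN]
        field_simp
  have hsum := intervalIntegral.sum_integral_adjacent_intervals
    (f := fun x => |derivWithin f (Icc 0 T) x| / (1 + (f x / l) ^ 2)) (μ := MeasureTheory.volume)
    (a := fun k : ℕ => (k : ℝ) * (T / M)) (n := M) (fun k hk => by
      refine ContinuousOn.intervalIntegrable (hc1.mono ?_)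
      have h1 : (k : ℝ) * (T / M) ≤ ((k + 1 : ℕ) : ℝ) * (T / M) := by
        gcongr; omega
      rw [uIcc_of_le h1]
      exact Icc_subset_Icc (by positivity) (hpt _ hk))
  have hMT : (M : ℝ) * (T / M) = T := by field_simp
  simp only [Nat.cast_zero, zero_mul, hMT] at hsum
  rw [← hsum]
  have hle : ∀ k ∈ Finset.range M, ∫ x in ((k : ℝ) * (T / M))..(((k + 1 : ℕ) : ℝ) * (T / M)),
      |derivWithin f (Icc 0 T) x| / (1 + (f x / l) ^ 2) ≤ l * (3 * Real.pi * 2 ^ m + 1) := by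
    intro k hk
    have hk := Finset.mem_range.1 hk
    refine interval_bound T hT m α hα f B hB.le hf hH l hl _ _ (by positivity) ?_ (hpt _ hk) ?_
    · gcongr; omega
    · have : ((k + 1 : ℕ) : ℝ) * (T / M) - k * (T / M) = T / M := by push_cast; ring
      rw [this]
      exact hsm
  refine (Finset.sum_le_sum hle).trans ?_
  have hpi := Real.pi_pos
  rw [Finset.sum_const, Finset.card_range, nsmul_eq_mul]
  have : (M : ℝ) ≤ (T + 2) * X := by linarith
  calc (M : ℝ) * (l * (3 * Real.pi * 2 ^ m + 1)) ≤ ((T + 2) * X) * (l * (3 * Real.pi * 2 ^ m + 1)) := by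
        gcongr
    _ = _ := by ring

lemma dyadic_pointwise (y r : ℝ) (K : ℕ) (hy : 0 ≤ y) (hr : 0 < r) (hK : y ≤ 2 ^ K * r) :
    1 / (y + r) ≤ ∑ k ∈ Finset.range (K + 1), 4 / (2 ^ k * r) * (1 / (1 + (y / (2 ^ k * r)) ^ 2)) := by
  classical
  have hex : ∃ k : ℕ, y ≤ 2 ^ k * r := ⟨K, hK⟩
  set k := Nat.find hex with hk
  have h1 : y ≤ 2 ^ k * r := Nat.find_spec hex
  have hkK : k ≤ K := Nat.find_min' hex hK
  have h2 : 2 ^ k * r ≤ 2 * (y + r) := by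
    rcases Nat.eq_zero_or_pos k with h0 | h0
    · rw [h0, pow_zero]; linarith
    · have h3 := Nat.find_min hex (m := k - 1) (by omega)
      push Not at h3
      have h4 : (2:ℝ) ^ k = 2 * 2 ^ (k - 1) := by rw [← pow_succ']; congr 1; omega
      rw [h4]
      nlinarith
  refine le_trans ?_ (Finset.single_le_sum
    (f := fun k => 4 / (2 ^ k * r) * (1 / (1 + (y / (2 ^ k * r)) ^ 2)))
    (fun i _ => by positivity) (Finset.mem_range.2 (Nat.lt_succ_of_le hkK)))
  have hl : 0 < 2 ^ k * r := by positivity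
  generalize 2 ^ k * r = l at h1 h2 hl ⊢
  have hu : (y / l) ^ 2 ≤ 1 := by
    have h3 : 0 ≤ y / l := by positivity
    have h4 : y / l ≤ 1 := (div_le_one hl).2 h1
    nlinarith
  have hu0 : 0 < 1 + (y / l) ^ 2 := by positivity
  rw [div_mul_div_comm, div_le_div_iff₀ (by linarith) (by positivity)]
  nlinarith

theorem stmt6 (T : ℝ) (hT : 0 < T) (n : ℕ) (hn : 1 ≤ n) (α : ℝ) (hα0 : 0 ≤ α) (hα1 : α ≤ 1) :
    ∃ C : ℝ, 0 < C ∧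
      ∀ (f : ℝ → ℝ) (B r : ℝ),
        (∀ t ∈ Icc (0:ℝ) T, 0 ≤ f t) →
        ContDiffOn ℝ n f (Icc 0 T) →
        (∃ H : ℝ, ∀ t ∈ Icc (0:ℝ) T, ∀ t' ∈ Icc (0:ℝ) T,
          |iteratedDerivWithin n f (Icc 0 T) t - iteratedDerivWithin n f (Icc 0 T) t'| ≤
            H * |t - t'| ^ α) →
        cnaNorm n α T f ≤ B → 0 < r →
        ∀ t ∈ Icc (0:ℝ) T,
          (∫ σ in (0:ℝ)..t, |derivWithin f (Icc 0 T) σ| / (f σ + r)) ≤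
            C * B ^ (1/((n : ℝ) + α)) * r ^ (-(1/((n : ℝ) + α))) := by
  obtain ⟨m, rfl⟩ : ∃ m, n = m + 1 := ⟨n - 1, by omega⟩
  have hNe : ((m + 1 : ℕ) : ℝ) + α = (m : ℝ) + α + 1 := by push_cast; ring
  rw [hNe]
  set N : ℝ := (m : ℝ) + α + 1 with hN
  have hm0 : (0:ℝ) ≤ m := by positivity
  have hN1 : 1 ≤ N := by linarith
  have hp0 : 0 < 1 / N := by positivity
  have hp1 : 1 / N ≤ 1 := (div_le_one (by linarith)).2 hN1
  set p : ℝ := 1 / N with hp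
  set q : ℝ := (1 / 2 : ℝ) ^ p with hq
  have hq0 : 0 < q := Real.rpow_pos_of_pos (by norm_num) _
  have hq1 : q < 1 := Real.rpow_lt_one (by norm_num) (by norm_num) hp0
  have hpi := Real.pi_pos
  set A : ℝ := 3 * Real.pi * 2 ^ m + 1 with hA
  have hA0 : 0 < A := by positivity
  have hq' : 0 < 1 - q := by linarith
  refine ⟨T + 4 * (A * (T + 2)) * (1 - q)⁻¹, by positivity, ?_⟩
  intro f B r hf0 hf hH hB hr t ht
  obtain ⟨hB0, hfB, hDB, hHB⟩ := cna_facts T hT (m + 1) hn α f B hf hH hB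
  have hu := uniqueDiffOn_Icc hT
  have hg' : ContDiffOn ℝ m (derivWithin f (Icc 0 T)) (Icc 0 T) :=
    hf.derivWithin hu (by push_cast; exact le_rfl)
  have hfc : ContinuousOn f (Icc 0 T) := hf.continuousOn
  have hDc : ContinuousOn (derivWithin f (Icc 0 T)) (Icc 0 T) := hg'.continuousOn
  have hc1 : ContinuousOn (fun x => |derivWithin f (Icc 0 T) x| / (f x + r)) (Icc 0 T) :=
    hDc.abs.div (by fun_prop) fun x hx => by have := hf0 x hx; positivity
  have hi1 : IntervalIntegrable (fun x => |derivWithin f (Icc 0 T) x| / (f x + r))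
      MeasureTheory.volume 0 T :=
    ContinuousOn.intervalIntegrable (by rwa [uIcc_of_le hT.le])
  have hext : (∫ σ in (0:ℝ)..t, |derivWithin f (Icc 0 T) σ| / (f σ + r)) ≤
      ∫ σ in (0:ℝ)..T, |derivWithin f (Icc 0 T) σ| / (f σ + r) := by
    refine intervalIntegral.integral_mono_interval le_rfl ht.1 ht.2 ?_ hi1
    refine (MeasureTheory.ae_restrict_iff' measurableSet_Ioc).2 (Filter.Eventually.of_forall ?_)
    intro x hx
    have := hf0 x ⟨hx.1.le, hx.2⟩
    simp only [Pi.zero_apply]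
    positivity
  refine hext.trans ?_
  have hXe : B ^ p * r ^ (-p) = (B / r) ^ p := by
    rw [Real.div_rpow hB0 hr.le, Real.rpow_neg hr.le, div_eq_mul_inv]
  rw [mul_assoc, hXe]
  have hX0 : 0 ≤ (B / r) ^ p := Real.rpow_nonneg (by positivity) _
  rcases le_or_gt B r with hBr | hBr
  · -- trivial case
    have h1 : (∫ σ in (0:ℝ)..T, |derivWithin f (Icc 0 T) σ| / (f σ + r)) ≤
        ∫ σ in (0:ℝ)..T, B / r := by
      refine intervalIntegral.integral_mono_on hT.le hi1 (by simp) fun x hx => ?_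
      have h2 := hf0 x hx
      have h3 := hDB x hx
      gcongr
      linarith
    have h2 : B / r ≤ (B / r) ^ p :=
      Real.self_le_rpow_of_le_one (by positivity) ((div_le_one hr).2 hBr) hp1
    simp only [intervalIntegral.integral_const, smul_eq_mul, sub_zero] at h1
    refine h1.trans ?_
    calc T * (B / r) ≤ T * (B / r) ^ p := by gcongr
      _ ≤ _ := by
        refine mul_le_mul_of_nonneg_right ?_ hX0
        have : 0 ≤ 4 * (A * (T + 2)) * (1 - q)⁻¹ := by positivity
        linarith
  · have hBpos : 0 < B := hr.trans hBr
    classical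
    have hex : ∃ k : ℕ, B ≤ 2 ^ k * r := by
      obtain ⟨k, hk⟩ := pow_unbounded_of_one_lt (B / r) (one_lt_two (α := ℝ))
      exact ⟨k, ((div_lt_iff₀ hr).1 hk).le⟩
    set K := Nat.find hex with hKdef
    have hK1 : B ≤ 2 ^ K * r := Nat.find_spec hex
    have hK2 : 2 ^ K * r ≤ 2 * B := by
      rcases Nat.eq_zero_or_pos K with h0 | h0
      · rw [h0, pow_zero]; linarith
      · have h3 := Nat.find_min hex (m := K - 1) (by omega)
        push Not at h3
        have h4 : (2:ℝ) ^ K = 2 * 2 ^ (K - 1) := by rw [← pow_succ']; congr 1; omega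
        rw [h4]
        nlinarith
    have hci : ∀ k : ℕ, IntervalIntegrable (fun x => 4 / (2 ^ k * r) *
        (|derivWithin f (Icc 0 T) x| / (1 + (f x / (2 ^ k * r)) ^ 2))) MeasureTheory.volume 0 T := by
      intro k
      refine ContinuousOn.intervalIntegrable ?_
      rw [uIcc_of_le hT.le]
      refine continuousOn_const.mul (hDc.abs.div (by fun_prop) fun x _ => by positivity)
    have h1 : (∫ σ in (0:ℝ)..T, |derivWithin f (Icc 0 T) σ| / (f σ + r)) ≤
        ∫ σ in (0:ℝ)..T, ∑ k ∈ Finset.range (K + 1), 4 / (2 ^ k * r) *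
          (|derivWithin f (Icc 0 T) σ| / (1 + (f σ / (2 ^ k * r)) ^ 2)) := by
      refine intervalIntegral.integral_mono_on hT.le hi1
        (by
          have := IntervalIntegrable.sum (Finset.range (K + 1)) fun k _ => hci k
          rwa [Finset.sum_fn] at this)
        fun x hx => ?_
      have h2 := dyadic_pointwise (f x) r K (hf0 x hx) hr
        (((le_abs_self _).trans (hfB x hx)).trans hK1)
      have h3 := mul_le_mul_of_nonneg_left h2 (abs_nonneg (derivWithin f (Icc 0 T) x))
      rw [mul_one_div, Finset.mul_sum] at h3
      refine h3.trans (le_of_eq (Finset.sum_congr rfl fun k _ => ?_))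
      ring
    refine h1.trans ?_
    rw [intervalIntegral.integral_finsetSum fun k _ => hci k]
    have h2 : ∀ k ∈ Finset.range (K + 1), (∫ σ in (0:ℝ)..T, 4 / (2 ^ k * r) *
          (|derivWithin f (Icc 0 T) σ| / (1 + (f σ / (2 ^ k * r)) ^ 2))) ≤
        4 * (A * (T + 2)) * (B / r) ^ p * q ^ k := by
      intro k hk
      have hkK : k ≤ K := Nat.lt_succ_iff.1 (Finset.mem_range.1 hk)
      have hl : 0 < 2 ^ k * r := by positivity
      have hlB : 2 ^ k * r ≤ 2 * B := by
        refine le_trans ?_ hK2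
        gcongr
        norm_num
      have h3 := level_bound T hT m α hα0 f B hBpos hf hHB _ hl hlB
      rw [intervalIntegral.integral_const_mul]
      refine (mul_le_mul_of_nonneg_left h3 (by positivity)).trans (le_of_eq ?_)
      have h4 : (B / (2 ^ k * r)) ^ p = (B / r) ^ p * q ^ k := by
        have h6 : q ^ k = ((1 / 2 : ℝ) ^ k) ^ p := by
          rw [hq, ← Real.rpow_natCast, ← Real.rpow_natCast, ← Real.rpow_mul (by norm_num),
            ← Real.rpow_mul (by norm_num), mul_comm p]
        rw [h6, ← Real.mul_rpow (by positivity) (by positivity)]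
        congr 1
        rw [one_div, inv_pow]
        field_simp
      rw [← hA, ← hN, ← hp, h4]
      field_simp
    refine (Finset.sum_le_sum h2).trans ?_
    rw [← Finset.mul_sum]
    have h5 : ∑ k ∈ Finset.range (K + 1), q ^ k ≤ (1 - q)⁻¹ := by
      rw [← tsum_geometric_of_lt_one hq0.le hq1]
      exact (summable_geometric_of_lt_one hq0.le hq1).sum_le_tsum _ fun i _ => by positivity
    calc 4 * (A * (T + 2)) * (B / r) ^ p * ∑ k ∈ Finset.range (K + 1), q ^ k
        ≤ 4 * (A * (T + 2)) * (B / r) ^ p * (1 - q)⁻¹ := by gcongr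
      _ ≤ _ := by nlinarith
end

section
/- Let T>0, let n≥1 be an integer and 0≤α≤1, let b:[0,T]→ℝ be nonnegative of class C^{n,α}, let a∈𝒢^s(ℝ) (s>1) be nonnegative, let 0<δ<1 and set κ̃=2δ/(n+α). Then there exists B>0, independent of μ∈(0,1], such that Λ(t,x,ξ) ≤ B·⟨ξ⟩_μ^{κ̃} for all t∈[0,T], x,ξ∈ℝ and 0<μ≤1. -/
open scoped ContDiff

open Set

/-- `b` is of class `C^{n,α}` on `[0,T]`: `n` times continuously differentiable with
`b⁽ⁿ⁾` α-Hölder continuous. -/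
def CnAlpha (n : ℕ) (α T : ℝ) (b : ℝ → ℝ) : Prop :=
  ContDiffOn ℝ n b (Icc 0 T) ∧
    ∃ H : ℝ, ∀ t ∈ Icc (0:ℝ) T, ∀ t' ∈ Icc (0:ℝ) T,
      |iteratedDerivWithin n b (Icc 0 T) t - iteratedDerivWithin n b (Icc 0 T) t'| ≤
        H * |t - t'| ^ α

/-- `Λ(t,x,ξ) = ∫₀ᵗ |b'(σ)| φ(x,ξ) / (b(σ) φ(x,ξ) + ⟨ξ⟩_μ^(-2δ)) dσ`,
with `b'` the derivative of `b` within `[0,T]`. -/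
noncomputable def Lam (b a : ℝ → ℝ) (T δ μ t x ξ : ℝ) : ℝ :=
  ∫ σ in (0:ℝ)..t,
    |derivWithin b (Icc 0 T) σ| * phi a δ μ x ξ /
      (b σ * phi a δ μ x ξ + br μ ξ ^ (-(2*δ)))

open MeasureTheory

/-- Every polynomial of degree at most `n` has a primitive of degree at most `n+1`
with a prescribed value at `c`. -/
lemma exists_primitive (n : ℕ) (Q : Polynomial ℝ) (hQ : Q.natDegree ≤ n) (c v : ℝ) :
    ∃ P : Polynomial ℝ, P.natDegree ≤ n + 1 ∧ P.derivative = Q ∧ P.eval c = v := by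
  obtain ⟨P, hP1, hP2⟩ : ∃ P : Polynomial ℝ, P.natDegree ≤ n + 1 ∧ P.derivative = Q := by
    refine ⟨∑ i ∈ Finset.range (n+1), Polynomial.C (Q.coeff i / (i+1)) * Polynomial.X ^ (i+1),
      ?_, ?_⟩
    · apply Polynomial.natDegree_sum_le_of_forall_le
      intro i hi
      refine (Polynomial.natDegree_C_mul_X_pow_le _ _).trans ?_
      have := Finset.mem_range.1 hi
      omega
    · conv_rhs => rw [Q.as_sum_range_C_mul_X_pow' (Nat.lt_succ_of_le hQ)]
      rw [Polynomial.derivative_sum]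
      refine Finset.sum_congr rfl fun i _ => ?_
      rw [Polynomial.derivative_C_mul_X_pow]
      simp only [Nat.add_sub_cancel]
      congr 2
      push_cast
      have : (i:ℝ) + 1 ≠ 0 := by positivity
      field_simp
  refine ⟨P + Polynomial.C (v - P.eval c), ?_, by simp [hP2], by simp⟩
  rw [Polynomial.natDegree_add_C]; exact hP1

lemma taylor_step (T : ℝ) (hT : 0 < T) (f f' : ℝ → ℝ) (P Q : Polynomial ℝ) (H β c : ℝ)
    (hH : 0 ≤ H) (hβ : 0 ≤ β)
    (hc : c ∈ Icc (0:ℝ) T) (hf : ∀ t ∈ Icc (0:ℝ) T, HasDerivWithinAt f (f' t) (Icc 0 T) t)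
    (hPQ : P.derivative = Q) (hPc : P.eval c = f c)
    (hQ : ∀ t ∈ Icc c T, |f' t - Q.eval t| ≤ H * (t - c) ^ β) :
    ∀ t ∈ Icc c T, |f t - P.eval t| ≤ H * (t - c) ^ (β + 1) := by
  intro t ht
  have hsub : Icc c t ⊆ Icc 0 T := Icc_subset_Icc hc.1 ht.2
  have key := Convex.norm_image_sub_le_of_norm_hasDerivWithin_le
    (f := fun u => f u - P.eval u) (f' := fun u => f' u - Q.eval u) (s := Icc c t)
    (x := c) (y := t) (C := H * (t - c) ^ β) ?_ ?_ (convex_Icc c t)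
    (left_mem_Icc.2 ht.1) (right_mem_Icc.2 ht.1)
  · have h0 : (0:ℝ) ≤ t - c := sub_nonneg.2 ht.1
    simp only [hPc, sub_self, sub_zero, Real.norm_eq_abs, abs_of_nonneg h0] at key
    rw [Real.rpow_add_one' h0 (by linarith), ← mul_assoc]
    exact key
  · intro u hu
    refine ((hf u (hsub hu)).mono hsub).sub ?_
    rw [← hPQ]
    exact (P.hasDerivAt u).hasDerivWithinAt
  · intro u hu
    refine (hQ u ⟨hu.1, hu.2.trans ht.2⟩).trans ?_
    have : (0:ℝ) ≤ u - c := sub_nonneg.2 hu.1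
    have : u - c ≤ t - c := by linarith [hu.2]
    gcongr

/-- Taylor approximation in Hölder classes. -/
lemma taylor_holder (T : ℝ) (hT : 0 < T) (α H : ℝ) (hα0 : 0 ≤ α) (hH : 0 ≤ H)
    (c : ℝ) (hc : c ∈ Icc (0:ℝ) T) (n : ℕ) :
    ∀ f : ℝ → ℝ, ContDiffOn ℝ n f (Icc 0 T) →
    (∀ t ∈ Icc (0:ℝ) T, ∀ t' ∈ Icc (0:ℝ) T,
      |iteratedDerivWithin n f (Icc 0 T) t - iteratedDerivWithin n f (Icc 0 T) t'| ≤
        H * |t - t'| ^ α) →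
    ∃ P : Polynomial ℝ, P.natDegree ≤ n ∧
      ∀ t ∈ Icc c T, |f t - P.eval t| ≤ H * (t - c) ^ ((n:ℝ) + α) := by
  induction n with
  | zero =>
    intro f _ hf
    refine ⟨Polynomial.C (f c), by simp, fun t ht => ?_⟩
    have := hf t ⟨hc.1.trans ht.1, ht.2⟩ c hc
    simpa [abs_of_nonneg (sub_nonneg.2 ht.1)] using this
  | succ n ih =>
    intro f hfc hf
    have hu : UniqueDiffOn ℝ (Icc (0:ℝ) T) := uniqueDiffOn_Icc hT
    obtain ⟨Q, hQd, hQ⟩ := ih (derivWithin f (Icc 0 T))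
      (hfc.derivWithin hu (by push_cast; rfl)) (by rw [iteratedDerivWithin_succ'] at hf; exact hf)
    obtain ⟨P, hPd, hPQ, hPc⟩ := exists_primitive n Q hQd c (f c)
    refine ⟨P, hPd, ?_⟩
    have := taylor_step T hT f (derivWithin f (Icc 0 T)) P Q H (n + α) c hH (by positivity) hc
      (fun t ht => ((hfc.differentiableOn (by simp)) t ht).hasDerivWithinAt) hPQ hPc hQ
    intro t ht
    have h := this t ht
    push_cast
    rwa [add_right_comm]

/-- Area bound for a polynomial whose derivative vanishes only on a finite set. -/
lemma poly_area_aux (P : Polynomial ℝ) (L : ℝ) (m : ℕ) :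
    ∀ (S : Finset ℝ) (c d : ℝ), S.card = m →
      (∀ x ∈ Ioo c d, P.derivative.eval x = 0 → x ∈ S) →
      ∫⁻ x in Icc c d ∩ {x | |P.eval x| ≤ L}, ENNReal.ofReal |P.derivative.eval x|
        ≤ (m + 1 : ℕ) * ENNReal.ofReal (2 * L) := by
  induction m using Nat.strong_induction_on with
  | _ m ih =>
    intro S c d hS hroot
    by_cases hex : ∃ s ∈ S, s ∈ Ioo c d
    · obtain ⟨s, hsS, hs⟩ := hex
      have hA : (S.filter (· < s)).card + (S.filter (s < ·)).card + 1 ≤ m := by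
        rw [← hS, ← Finset.card_union_of_disjoint]
        · refine Nat.succ_le_of_lt (Finset.card_lt_card ?_)
          refine ⟨by intro x hx; simp at hx; tauto, fun h => ?_⟩
          have := h hsS
          simp at this
        · rw [Finset.disjoint_filter]
          intro x _ h1 h2
          exact lt_asymm h1 h2
      have h1 := ih _ (by omega) (S.filter (· < s)) c s rfl (by
        intro x hx h0
        exact Finset.mem_filter.2 ⟨hroot x ⟨hx.1, hx.2.trans hs.2⟩ h0, hx.2⟩)
      have h2 := ih _ (by omega) (S.filter (s < ·)) s d rfl (by
        intro x hx h0
        exact Finset.mem_filter.2 ⟨hroot x ⟨hs.1.trans hx.1, hx.2⟩ h0, hx.1⟩)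
      have hun : Icc c d ∩ {x | |P.eval x| ≤ L} ⊆
          (Icc c s ∩ {x | |P.eval x| ≤ L}) ∪ (Icc s d ∩ {x | |P.eval x| ≤ L}) := by
        rintro x ⟨hx, hx'⟩
        rcases le_total x s with h | h
        · exact Or.inl ⟨⟨hx.1, h⟩, hx'⟩
        · exact Or.inr ⟨⟨h, hx.2⟩, hx'⟩
      refine (lintegral_mono_set hun).trans ((lintegral_union_le _ _ _).trans
        ((add_le_add h1 h2).trans ?_))
      rw [← add_mul]
      gcongr
      rw [← Nat.cast_add]
      exact_mod_cast (by omega)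
    · push Not at hex
      have hinj : InjOn (fun x => P.eval x) (Icc c d) := by
        have key : ∀ x ∈ Icc c d, ∀ y ∈ Icc c d, x < y → P.eval x ≠ P.eval y := by
          intro x hx y hy hxy he
          obtain ⟨z, hz, hz0⟩ := exists_deriv_eq_zero hxy (P.continuous.continuousOn) he
          rw [P.deriv] at hz0
          have hz' : z ∈ Ioo c d := ⟨hx.1.trans_lt hz.1, hz.2.trans_le hy.2⟩
          exact hex z (hroot z hz' hz0) hz'
        intro x hx y hy he
        rcases lt_trichotomy x y with h | h | h
        · exact absurd he (key x hx y hy h)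
        · exact h
        · exact absurd he.symm (key y hy x hx h)
      have hms : MeasurableSet (Icc c d ∩ {x | |P.eval x| ≤ L}) :=
        measurableSet_Icc.inter
          (isClosed_le P.continuous.abs continuous_const).measurableSet
      have := lintegral_image_eq_lintegral_abs_deriv_mul hms
        (fun x _ => (P.hasDerivAt x).hasDerivWithinAt) (hinj.mono inter_subset_left)
        (fun _ => 1)
      simp only [mul_one, lintegral_const, one_mul, Measure.restrict_apply_univ] at this
      rw [← this]
      have hsub : (fun x => P.eval x) '' (Icc c d ∩ {x | |P.eval x| ≤ L}) ⊆ Icc (-L) L := by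
        rintro _ ⟨x, hx, rfl⟩
        exact abs_le.1 hx.2
      refine (measure_mono hsub).trans ?_
      rw [Real.volume_Icc]
      have e : L - -L = 2 * L := by ring
      rw [e]
      exact le_mul_of_one_le_left zero_le (by exact_mod_cast Nat.le_add_left 1 m)

lemma poly_area (P : Polynomial ℝ) (L c d : ℝ) (n : ℕ) (hn : P.derivative.natDegree ≤ n) :
    ∫⁻ x in Icc c d ∩ {x | |P.eval x| ≤ L}, ENNReal.ofReal |P.derivative.eval x|
        ≤ (n + 1 : ℕ) * ENNReal.ofReal (2 * L) := by
  by_cases h0 : P.derivative = 0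
  · simp [h0]
  · refine (poly_area_aux P L _ P.derivative.roots.toFinset c d rfl ?_).trans ?_
    · intro x _ hx
      simp [h0, hx]
    · gcongr
      exact (Multiset.toFinset_card_le _).trans ((Polynomial.card_roots' _).trans hn)

/-- Estimate on one small interval. -/
lemma local_est (T : ℝ) (hT : 0 < T) (n : ℕ) (α H : ℝ) (hα0 : 0 ≤ α) (hH : 0 ≤ H)
    (b : ℝ → ℝ) (hbc : ContDiffOn ℝ (n+1 : ℕ) b (Icc 0 T))
    (hb : ∀ t ∈ Icc (0:ℝ) T, ∀ t' ∈ Icc (0:ℝ) T,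
      |iteratedDerivWithin (n+1) b (Icc 0 T) t - iteratedDerivWithin (n+1) b (Icc 0 T) t'| ≤
        H * |t - t'| ^ α)
    (hb0 : ∀ t ∈ Icc (0:ℝ) T, 0 ≤ b t)
    (c h l : ℝ) (hc : c ∈ Icc (0:ℝ) T) (hh : 0 < h) (hl : l = h ^ ((n:ℝ) + α + 1)) :
    ∫⁻ t in Icc c (c+h) ∩ Icc 0 T ∩ {t | b t ≤ 2 * l},
        ENNReal.ofReal |derivWithin b (Icc 0 T) t| ≤
      ENNReal.ofReal ((H + (n+1) * (2 * (2 + H))) * l) := by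
  have hl0 : 0 < l := by rw [hl]; positivity
  have hu : UniqueDiffOn ℝ (Icc (0:ℝ) T) := uniqueDiffOn_Icc hT
  obtain ⟨Q, hQd, hQ⟩ := taylor_holder T hT α H hα0 hH c hc n (derivWithin b (Icc 0 T))
      (hbc.derivWithin hu (by push_cast; rfl)) (by rw [iteratedDerivWithin_succ'] at hb; exact hb)
  obtain ⟨P, hPd, hPQ, hPc⟩ := exists_primitive n Q hQd c (b c)
  have hP := taylor_step T hT b (derivWithin b (Icc 0 T)) P Q H (n + α) c hH (by positivity) hc
      (fun t ht => ((hbc.differentiableOn (by simp)) t ht).hasDerivWithinAt) hPQ hPc hQ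
  have hsub : Icc c (c+h) ∩ Icc 0 T ∩ {t | b t ≤ 2 * l} ⊆
      Icc c (c+h) ∩ {t | |P.eval t| ≤ (2 + H) * l} := by
    rintro t ⟨⟨h1, h2⟩, h3⟩
    refine ⟨h1, ?_⟩
    have hp := hP t ⟨h1.1, h2.2⟩
    have : (t - c) ^ ((n:ℝ) + α + 1) ≤ l := by
      rw [hl]
      have : (0:ℝ) ≤ t - c := sub_nonneg.2 h1.1
      have : t - c ≤ h := by linarith [h1.2]
      gcongr
    have hp2 : |b t - P.eval t| ≤ H * l := hp.trans (by gcongr)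
    have hb0' := hb0 t h2
    simp only [mem_ofPred_eq] at h3 ⊢
    rw [abs_le] at hp2 ⊢
    constructor <;> nlinarith [hp2.1, hp2.2]
  set K := H * h ^ ((n:ℝ) + α) with hK
  have hKh : K * h = H * l := by
    rw [hK, hl, Real.rpow_add_one hh.ne', mul_assoc]
  have hm : Measurable fun t => ENNReal.ofReal |Q.eval t| :=
    (ENNReal.continuous_ofReal.comp Q.continuous.abs).measurable
  have hms : MeasurableSet (Icc c (c+h) ∩ Icc 0 T ∩ {t | b t ≤ 2 * l}) := by
    have hcl : IsClosed (Icc 0 T ∩ b ⁻¹' (Iic (2*l))) :=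
      hbc.continuousOn.preimage_isClosed_of_isClosed isClosed_Icc isClosed_Iic
    rw [inter_assoc]
    exact measurableSet_Icc.inter hcl.measurableSet
  calc ∫⁻ t in Icc c (c+h) ∩ Icc 0 T ∩ {t | b t ≤ 2 * l},
        ENNReal.ofReal |derivWithin b (Icc 0 T) t|
      ≤ ∫⁻ t in Icc c (c+h) ∩ Icc 0 T ∩ {t | b t ≤ 2 * l},
        (ENNReal.ofReal |Q.eval t| + ENNReal.ofReal K) := by
        refine setLIntegral_mono' hms ?_
        rintro t ⟨⟨h1, h2⟩, h3⟩
        rw [← ENNReal.ofReal_add (abs_nonneg _) (by positivity)]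
        apply ENNReal.ofReal_le_ofReal
        have hq := hQ t ⟨h1.1, h2.2⟩
        have : (t - c) ^ ((n:ℝ) + α) ≤ h ^ ((n:ℝ) + α) := by
          have : (0:ℝ) ≤ t - c := sub_nonneg.2 h1.1
          have : t - c ≤ h := by linarith [h1.2]
          gcongr
        have hq2 : |derivWithin b (Icc 0 T) t - Q.eval t| ≤ K := hq.trans (by rw [hK]; gcongr)
        have := abs_sub_abs_le_abs_sub (derivWithin b (Icc 0 T) t) (Q.eval t)
        linarith
    _ = (∫⁻ t in Icc c (c+h) ∩ Icc 0 T ∩ {t | b t ≤ 2 * l}, ENNReal.ofReal |Q.eval t|) +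
        ∫⁻ t in Icc c (c+h) ∩ Icc 0 T ∩ {t | b t ≤ 2 * l}, ENNReal.ofReal K :=
        lintegral_add_left hm _
    _ ≤ (∫⁻ t in Icc c (c+h) ∩ {t | |P.eval t| ≤ (2 + H) * l},
          ENNReal.ofReal |P.derivative.eval t|) + ∫⁻ t in Icc c (c+h), ENNReal.ofReal K := by
        rw [hPQ]
        refine add_le_add (lintegral_mono_set hsub) (lintegral_mono_set ?_)
        exact fun t ht => ht.1.1
    _ ≤ (n + 1 : ℕ) * ENNReal.ofReal (2 * ((2 + H) * l)) + ENNReal.ofReal (H * l) := by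
        refine add_le_add (poly_area P _ _ _ n (by rw [hPQ]; exact hQd)) ?_
        rw [setLIntegral_const, Real.volume_Icc, ← ENNReal.ofReal_mul (by positivity)]
        rw [add_sub_cancel_left, hKh]
    _ = ENNReal.ofReal ((H + (n+1) * (2 * (2 + H))) * l) := by
        rw [← ENNReal.ofReal_natCast, ← ENNReal.ofReal_mul (by positivity),
          ← ENNReal.ofReal_add (by positivity) (by positivity)]
        congr 1
        push_cast
        ring

/-- Estimate on one dyadic level. -/
lemma level_est (T : ℝ) (hT : 0 < T) (n : ℕ) (α H : ℝ) (hα0 : 0 ≤ α) (hH : 0 ≤ H)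
    (b : ℝ → ℝ) (hbc : ContDiffOn ℝ (n+1 : ℕ) b (Icc 0 T))
    (hb : ∀ t ∈ Icc (0:ℝ) T, ∀ t' ∈ Icc (0:ℝ) T,
      |iteratedDerivWithin (n+1) b (Icc 0 T) t - iteratedDerivWithin (n+1) b (Icc 0 T) t'| ≤
        H * |t - t'| ^ α)
    (hb0 : ∀ t ∈ Icc (0:ℝ) T, 0 ≤ b t)
    (h l D : ℝ) (hh : 0 < h) (hl : l = h ^ ((n:ℝ) + α + 1)) (hD : h ≤ D) :
    ∫⁻ t in Icc 0 T ∩ {t | b t ≤ 2 * l},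
        ENNReal.ofReal |derivWithin b (Icc 0 T) t| ≤
      ENNReal.ofReal ((T + D) / h * ((H + (n+1) * (2 * (2 + H))) * l)) := by
  have hl0 : 0 < l := by rw [hl]; positivity
  have hcov : Icc 0 T ∩ {t | b t ≤ 2 * l} ⊆ ⋃ i : Fin (⌊T/h⌋₊ + 1),
      Icc (i*h) (i*h+h) ∩ Icc 0 T ∩ {t | b t ≤ 2 * l} := by
    rintro t ⟨ht, ht'⟩
    have h0 : 0 ≤ t / h := div_nonneg ht.1 hh.le
    refine mem_iUnion.2 ⟨⟨⌊t/h⌋₊, Nat.lt_succ_of_le (Nat.floor_le_floor (by have := ht.2; gcongr))⟩,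
      ⟨⟨?_, ?_⟩, ht⟩, ht'⟩
    · exact (le_div_iff₀ hh).1 (Nat.floor_le h0)
    · have := (div_lt_iff₀ hh).1 (Nat.lt_floor_add_one (t/h))
      simp only
      linarith
  refine (lintegral_mono_set hcov).trans ((lintegral_iUnion_le _ _).trans ?_)
  rw [tsum_fintype]
  refine (Finset.sum_le_card_nsmul _ _
    (ENNReal.ofReal ((H + (n+1) * (2 * (2 + H))) * l)) ?_).trans ?_
  · intro i _
    refine local_est T hT n α H hα0 hH b hbc hb hb0 _ h l ⟨by positivity, ?_⟩ hh hl
    have h1 : ((i:ℕ):ℝ) ≤ ⌊T/h⌋₊ := by exact_mod_cast Nat.le_of_lt_succ i.2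
    exact (le_div_iff₀ hh).1 (h1.trans (Nat.floor_le (by positivity)))
  · rw [nsmul_eq_mul, ← ENNReal.ofReal_natCast, ← ENNReal.ofReal_mul (by positivity)]
    apply ENNReal.ofReal_le_ofReal
    gcongr
    simp only [Finset.card_univ, Fintype.card_fin]
    push_cast
    have h1 : (⌊T/h⌋₊:ℝ) ≤ T/h := Nat.floor_le (by positivity)
    have h2 : 1 ≤ D / h := (one_le_div hh).2 hD
    rw [add_div]
    linarith

/-- The main uniform estimate. -/
lemma main_est (T : ℝ) (hT : 0 < T) (n : ℕ) (α H : ℝ) (hα0 : 0 ≤ α) (hH : 0 ≤ H)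
    (b : ℝ → ℝ) (hbc : ContDiffOn ℝ (n+1 : ℕ) b (Icc 0 T))
    (hb : ∀ t ∈ Icc (0:ℝ) T, ∀ t' ∈ Icc (0:ℝ) T,
      |iteratedDerivWithin (n+1) b (Icc 0 T) t - iteratedDerivWithin (n+1) b (Icc 0 T) t'| ≤
        H * |t - t'| ^ α)
    (hb0 : ∀ t ∈ Icc (0:ℝ) T, 0 ≤ b t) :
    ∃ B : ℝ, 0 < B ∧ ∀ ε : ℝ, 0 < ε → ε ≤ 1 →
      ∫⁻ t in Icc 0 T, ENNReal.ofReal (|derivWithin b (Icc 0 T) t| / (b t + ε)) ≤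
        ENNReal.ofReal (B * ε ^ (-(1/((n:ℝ) + α + 1)))) := by
  obtain ⟨M, hM⟩ := isCompact_Icc.exists_bound_of_continuousOn hbc.continuousOn
  have hM0 : 0 ≤ M := (norm_nonneg _).trans (hM 0 ⟨le_rfl, hT.le⟩)
  set k : ℝ := (n:ℝ) + α + 1 with hk
  have hk0 : 0 < k := by positivity
  set D : ℝ := (M + 1) ^ (1/k) with hDdef
  have hD0 : 0 < D := by positivity
  set C1 : ℝ := H + (n+1) * (2 * (2 + H)) with hC1
  have hC10 : 0 < C1 := by positivity
  set r : ℝ := 2 ^ (-(1/k)) with hr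
  have hr0 : 0 < r := by positivity
  have hr1 : r < 1 := Real.rpow_lt_one_of_one_lt_of_neg one_lt_two (by
    have : 0 < 1/k := by positivity
    linarith)
  refine ⟨(T + D) * C1 * (1 - r)⁻¹, ?_, ?_⟩
  · have : 0 < 1 - r := by linarith
    positivity
  intro ε hε hε1
  have hcov : Icc 0 T ⊆ ⋃ j : ℕ, Icc 0 T ∩ {t | 2^j * ε ≤ b t + ε ∧ b t + ε < 2^(j+1) * ε} := by
    intro t ht
    have h1 : 1 ≤ (b t + ε) / ε := by
      rw [one_le_div hε]; linarith [hb0 t ht]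
    obtain ⟨j, hj1, hj2⟩ := exists_nat_pow_near h1 one_lt_two
    exact mem_iUnion.2 ⟨j, ht, (le_div_iff₀ hε).1 hj1, (div_lt_iff₀ hε).1 hj2⟩
  have hlev : ∀ j : ℕ, ∫⁻ t in Icc 0 T ∩ {t | 2^j * ε ≤ b t + ε ∧ b t + ε < 2^(j+1) * ε},
      ENNReal.ofReal (|derivWithin b (Icc 0 T) t| / (b t + ε)) ≤
      ENNReal.ofReal ((T + D) * C1 * ε ^ (-(1/k)) * r ^ j) := by
    intro j
    rcases (Icc 0 T ∩ {t | 2^j * ε ≤ b t + ε ∧ b t + ε < 2^(j+1) * ε}).eq_empty_or_nonempty with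
      he | ⟨t0, ht0, ht1, -⟩
    · rw [he]; simp
    set l : ℝ := 2^j * ε with hl
    have hl0 : 0 < l := by positivity
    have hlM : l ≤ M + 1 := by
      have := (le_abs_self _).trans (hM t0 ht0)
      linarith
    set h : ℝ := l ^ (1/k) with hh
    have hh0 : 0 < h := by positivity
    have hlh : l = h ^ k := by
      rw [hh, ← Real.rpow_mul hl0.le, one_div, inv_mul_cancel₀ hk0.ne', Real.rpow_one]
    have hhD : h ≤ D := by rw [hh, hDdef]; gcongr
    have hms : MeasurableSet (Icc 0 T ∩ {t | l ≤ b t + ε ∧ b t + ε < 2^(j+1) * ε}) := by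
      classical
      have hb1 : Measurable ((Icc 0 T).piecewise b (fun _ => (0:ℝ))) :=
        (hbc.continuousOn.measurable_piecewise (g := fun _ => (0:ℝ)) continuousOn_const
          measurableSet_Icc)
      have : Icc 0 T ∩ {t | l ≤ b t + ε ∧ b t + ε < 2^(j+1) * ε} =
        Icc 0 T ∩ {t | l ≤ (Icc 0 T).piecewise b (fun _ => (0:ℝ)) t + ε ∧
          (Icc 0 T).piecewise b (fun _ => (0:ℝ)) t + ε < 2^(j+1) * ε} := by
        ext t
        simp only [mem_inter_iff, mem_ofPred_eq, and_congr_right_iff]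
        intro ht
        rw [piecewise_eq_of_mem _ _ _ ht]
      rw [this]
      refine measurableSet_Icc.inter ((measurableSet_le measurable_const (hb1.add_const _)).inter
        (measurableSet_lt (hb1.add_const _) measurable_const))
    calc ∫⁻ t in Icc 0 T ∩ {t | l ≤ b t + ε ∧ b t + ε < 2^(j+1) * ε},
          ENNReal.ofReal (|derivWithin b (Icc 0 T) t| / (b t + ε))
        ≤ ∫⁻ t in Icc 0 T ∩ {t | l ≤ b t + ε ∧ b t + ε < 2^(j+1) * ε},
          ENNReal.ofReal (l⁻¹) * ENNReal.ofReal |derivWithin b (Icc 0 T) t| := by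
          refine setLIntegral_mono' hms ?_
          rintro t ⟨ht, h1, h2⟩
          rw [← ENNReal.ofReal_mul (by positivity)]
          apply ENNReal.ofReal_le_ofReal
          rw [div_eq_inv_mul]
          gcongr
      _ = ENNReal.ofReal (l⁻¹) *
          ∫⁻ t in Icc 0 T ∩ {t | l ≤ b t + ε ∧ b t + ε < 2^(j+1) * ε},
            ENNReal.ofReal |derivWithin b (Icc 0 T) t| :=
          lintegral_const_mul' _ _ ENNReal.ofReal_ne_top
      _ ≤ ENNReal.ofReal (l⁻¹) * ∫⁻ t in Icc 0 T ∩ {t | b t ≤ 2 * l},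
            ENNReal.ofReal |derivWithin b (Icc 0 T) t| := by
          refine mul_le_mul_right (lintegral_mono_set ?_) _
          intro t ht
          have h2 : b t + ε < 2^(j+1) * ε := ht.2.2
          refine ⟨ht.1, ?_⟩
          change b t ≤ 2 * l
          have : (2:ℝ)^(j+1) * ε = 2 * l := by rw [hl]; ring
          linarith
      _ ≤ ENNReal.ofReal (l⁻¹) * ENNReal.ofReal ((T + D) / h * (C1 * l)) := by
          gcongr
          exact level_est T hT n α H hα0 hH b hbc hb hb0 h l D hh0 hlh hhD
      _ = ENNReal.ofReal ((T + D) * C1 * ε ^ (-(1/k)) * r ^ j) := by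
          rw [← ENNReal.ofReal_mul (by positivity)]
          congr 1
          have e1 : h⁻¹ = r ^ j * ε ^ (-(1/k)) := by
            rw [hh, ← Real.rpow_neg hl0.le, hl, Real.mul_rpow (by positivity) hε.le, hr,
              ← Real.rpow_natCast, ← Real.rpow_natCast, ← Real.rpow_mul (by norm_num),
              ← Real.rpow_mul (by norm_num), mul_comm (j:ℝ)]
          rw [div_eq_mul_inv, e1]
          field_simp
  refine (lintegral_mono_set hcov).trans ((lintegral_iUnion_le _ _).trans
    ((ENNReal.tsum_le_tsum hlev).trans ?_))
  have hsum := summable_geometric_of_lt_one hr0.le hr1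
  rw [← ENNReal.ofReal_tsum_of_nonneg (fun j => by positivity) (hsum.mul_left _),
    tsum_mul_left, tsum_geometric_of_lt_one hr0.le hr1]
  apply ENNReal.ofReal_le_ofReal
  apply le_of_eq
  ring

theorem stmt7 (T : ℝ) (hT : 0 < T) (n : ℕ) (hn : 1 ≤ n) (α : ℝ) (hα0 : 0 ≤ α) (hα1 : α ≤ 1)
    (b : ℝ → ℝ) (hb : CnAlpha n α T b) (hb0 : ∀ t ∈ Icc (0:ℝ) T, 0 ≤ b t)
    (s δ : ℝ) (hs : 1 < s) (hδ0 : 0 < δ) (hδ1 : δ < 1)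
    (a : ℝ → ℝ) (ha : Gevrey s a) (ha0 : ∀ x, 0 ≤ a x) :
    ∃ B : ℝ, 0 < B ∧
      ∀ (μ t x ξ : ℝ), 0 < μ → μ ≤ 1 → t ∈ Icc (0:ℝ) T →
        Lam b a T δ μ t x ξ ≤ B * br μ ξ ^ (2*δ/((n : ℝ) + α)) := by
  obtain ⟨m, rfl⟩ : ∃ m, n = m + 1 := ⟨n - 1, by omega⟩
  obtain ⟨hbc, H, hH⟩ := hb
  obtain ⟨-, C₀, A₀, hC₀, -, hC⟩ := ha
  obtain ⟨B, hB0, hB⟩ := main_est T hT m α |H| hα0 (abs_nonneg _) b hbc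
    (fun t ht t' ht' => (hH t ht t' ht').trans (by gcongr; exact le_abs_self _)) hb0
  set k : ℝ := (m:ℝ) + α + 1 with hk
  have hk0 : 0 < k := by positivity
  refine ⟨B * (C₀ + 1) ^ (1/k), by positivity, ?_⟩
  intro μ t x ξ hμ0 hμ1 ht
  have hbr : 1 ≤ br μ ξ := by
    unfold br
    rw [Real.one_le_sqrt]
    have h1 : 1 ≤ μ⁻¹ := (one_le_inv₀ hμ0).2 hμ1
    nlinarith [sq_nonneg ξ]
  have hbr0 : 0 < br μ ξ := by linarith
  have hax : a x ≤ C₀ := by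
    have := hC x 0
    simp at this
    exact (le_abs_self _).trans this
  set w : ℝ := br μ ξ ^ (-(2*δ)) with hw
  have hw0 : 0 < w := by positivity
  have hw1 : w ≤ 1 := Real.rpow_le_one_of_one_le_of_nonpos hbr (by linarith)
  have hphi : phi a δ μ x ξ = a x + w := rfl
  set p : ℝ := phi a δ μ x ξ with hp
  have hp0 : 0 < p := by rw [hphi]; linarith [ha0 x]
  have hpC : p ≤ C₀ + 1 := by rw [hphi]; linarith
  have hwp : w ≤ p := by rw [hphi]; linarith [ha0 x]
  have hε1 : w / p ≤ 1 := (div_le_one hp0).2 hwp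
  have hε0 : 0 < w / p := by positivity
  have hmain := hB (w/p) hε0 hε1
  have hle : Lam b a T δ μ t x ξ ≤ B * (w/p) ^ (-(1/k)) := by
    unfold Lam
    rw [intervalIntegral.integral_of_le ht.1]
    refine (Real.le_norm_self _).trans ((norm_integral_le_lintegral_norm _).trans ?_)
    refine ENNReal.toReal_le_of_le_ofReal (by positivity) (le_trans ?_ hmain)
    have hsub : Ioc 0 t ⊆ Icc 0 T := fun u hu => ⟨hu.1.le, hu.2.trans ht.2⟩
    refine le_trans ?_ (lintegral_mono_set hsub)
    refine setLIntegral_mono' measurableSet_Ioc ?_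
    intro u hu
    apply ENNReal.ofReal_le_ofReal
    apply le_of_eq
    have hbu := hb0 u (hsub hu)
    rw [← hp, ← hw, Real.norm_eq_abs, abs_of_nonneg (by positivity)]
    have h1 : b u * p + w ≠ 0 := by positivity
    have h2 : b u + w / p ≠ 0 := by positivity
    field_simp
  refine hle.trans ?_
  rw [mul_assoc]
  gcongr
  have e1 : (w/p) ^ (-(1/k)) = p ^ (1/k) * br μ ξ ^ (2*δ/k) := by
    rw [Real.rpow_neg hε0.le, ← Real.inv_rpow hε0.le, inv_div, Real.div_rpow hp0.le hw0.le,
      div_eq_mul_inv, ← Real.rpow_neg hw0.le, hw, ← Real.rpow_mul hbr0.le]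
    congr 2
    ring
  have e2 : ((m + 1 : ℕ) : ℝ) + α = k := by rw [hk]; push_cast; ring
  rw [e1, e2]
  gcongr
end

section
/- Let T>0, let b∈C¹([0,T]) be nonnegative, let a∈𝒢^s(ℝ) (s>1) be nonnegative and let 0≤δ<1. Then there exist A>0 and C>0, independent of μ∈(0,1] and t∈[0,T], such that for all k,l∈ℕ, all x,ξ∈ℝ, all t∈[0,T] and all 0<μ≤1: |∂_x^{k}∂_ξ^{l}Λ(t,x,ξ)| ≤ C·A^{k+l}·(k+l)!·(1+(k+l)^{s-1}⟨ξ⟩_μ^{-δ})^{k+l}·Λ(t,x,ξ)·⟨ξ⟩_μ^{-l+δk}. -/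
open scoped ContDiff

open Set

/-- jointly smooth -/
def SM (f : ℝ → ℝ → ℝ) : Prop := ContDiff ℝ ∞ (fun p : ℝ × ℝ => f p.1 p.2)

noncomputable def Dxi (f : ℝ → ℝ → ℝ) : ℝ → ℝ → ℝ := fun x ξ => deriv (f x) ξ
noncomputable def Dx (f : ℝ → ℝ → ℝ) : ℝ → ℝ → ℝ := fun x ξ => deriv (fun x' => f x' ξ) x

lemma SM.left {f : ℝ → ℝ → ℝ} (hf : SM f) (ξ : ℝ) : ContDiff ℝ ∞ (fun x => f x ξ) := by
  have h : ContDiff ℝ ∞ (fun x : ℝ => ((x, ξ) : ℝ × ℝ)) := by fun_prop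
  exact ContDiff.comp (g := fun p : ℝ × ℝ => f p.1 p.2) hf h

lemma SM.right {f : ℝ → ℝ → ℝ} (hf : SM f) (x : ℝ) : ContDiff ℝ ∞ (fun ξ => f x ξ) := by
  have h : ContDiff ℝ ∞ (fun ξ : ℝ => ((x, ξ) : ℝ × ℝ)) := by fun_prop
  exact ContDiff.comp (g := fun p : ℝ × ℝ => f p.1 p.2) hf h

lemma SM.Dxi {f : ℝ → ℝ → ℝ} (hf : SM f) : SM (Dxi f) := by
  have h1 : ContDiff ℝ ∞ (fun p : ℝ × ℝ => fderiv ℝ (fun p : ℝ × ℝ => f p.1 p.2) p (0, 1)) :=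
    (hf.fderiv_right (m := ∞) (by simp)).clm_apply contDiff_const
  have : (fun p : ℝ × ℝ => _root_.Dxi f p.1 p.2) =
      (fun p : ℝ × ℝ => fderiv ℝ (fun p : ℝ × ℝ => f p.1 p.2) p (0, 1)) := by
    ext p
    have hd : HasFDerivAt (fun p : ℝ × ℝ => f p.1 p.2)
        (fderiv ℝ (fun p : ℝ × ℝ => f p.1 p.2) p) (p.1, p.2) :=
      (hf.differentiable (by simp) p).hasFDerivAt
    have hc : HasDerivAt (fun ξ : ℝ => ((p.1, ξ) : ℝ × ℝ)) (0, 1) p.2 :=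
      (hasDerivAt_const p.2 p.1).prodMk (hasDerivAt_id p.2)
    exact (hd.comp_hasDerivAt p.2 hc).deriv
  unfold SM
  rw [this]; exact h1

lemma SM.Dx {f : ℝ → ℝ → ℝ} (hf : SM f) : SM (Dx f) := by
  have h1 : ContDiff ℝ ∞ (fun p : ℝ × ℝ => fderiv ℝ (fun p : ℝ × ℝ => f p.1 p.2) p (1, 0)) :=
    (hf.fderiv_right (m := ∞) (by simp)).clm_apply contDiff_const
  have : (fun p : ℝ × ℝ => _root_.Dx f p.1 p.2) =
      (fun p : ℝ × ℝ => fderiv ℝ (fun p : ℝ × ℝ => f p.1 p.2) p (1, 0)) := by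
    ext p
    have hd : HasFDerivAt (fun p : ℝ × ℝ => f p.1 p.2)
        (fderiv ℝ (fun p : ℝ × ℝ => f p.1 p.2) p) (p.1, p.2) :=
      (hf.differentiable (by simp) p).hasFDerivAt
    have hc : HasDerivAt (fun x : ℝ => ((x, p.2) : ℝ × ℝ)) (1, 0) p.1 :=
      (hasDerivAt_id p.1).prodMk (hasDerivAt_const p.1 p.2)
    exact (hd.comp_hasDerivAt p.1 hc).deriv
  unfold SM
  rw [this]; exact h1

lemma SM.iter {f : ℝ → ℝ → ℝ} (hf : SM f) (l : ℕ) : SM (fun x ξ => iteratedDeriv l (f x) ξ) := by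
  induction l generalizing f with
  | zero => simpa using hf
  | succ l ih =>
    simp only [iteratedDeriv_succ']
    exact ih hf.Dxi

lemma SM.add {f g : ℝ → ℝ → ℝ} (hf : SM f) (hg : SM g) : SM (fun x ξ => f x ξ + g x ξ) :=
  ContDiff.add hf hg
lemma SM.sub {f g : ℝ → ℝ → ℝ} (hf : SM f) (hg : SM g) : SM (fun x ξ => f x ξ - g x ξ) :=
  ContDiff.sub hf hg
lemma SM.mul {f g : ℝ → ℝ → ℝ} (hf : SM f) (hg : SM g) : SM (fun x ξ => f x ξ * g x ξ) :=
  ContDiff.mul hf hg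
lemma SM.const (c : ℝ) : SM (fun _ _ => c) := contDiff_const
lemma SM.pow {f : ℝ → ℝ → ℝ} (hf : SM f) (n : ℕ) : SM (fun x ξ => f x ξ ^ n) :=
  ContDiff.pow hf n
lemma SM.sum {ι : Type} {f : ι → ℝ → ℝ → ℝ} (I : Finset ι) (hf : ∀ i ∈ I, SM (f i)) :
    SM (fun x ξ => ∑ i ∈ I, f i x ξ) :=
  ContDiff.sum hf

lemma pd_add {f g : ℝ → ℝ → ℝ} (hf : SM f) (hg : SM g) (k l : ℕ) (x ξ : ℝ) :
    pdXxi k l (fun x ξ => f x ξ + g x ξ) x ξ = pdXxi k l f x ξ + pdXxi k l g x ξ := by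
  unfold pdXxi
  have : (fun x' => iteratedDeriv l (fun ξ => f x' ξ + g x' ξ) ξ) =
      (fun x' => iteratedDeriv l (f x') ξ) + (fun x' => iteratedDeriv l (g x') ξ) := by
    ext x'
    exact iteratedDeriv_add ((hf.right x').contDiffAt.of_le (by exact_mod_cast le_top))
      ((hg.right x').contDiffAt.of_le (by exact_mod_cast le_top))
  rw [this]
  exact iteratedDeriv_add (((hf.iter l).left ξ).contDiffAt.of_le (by exact_mod_cast le_top))
      (((hg.iter l).left ξ).contDiffAt.of_le (by exact_mod_cast le_top))

lemma pd_mul {f g : ℝ → ℝ → ℝ} (hf : SM f) (hg : SM g) (k l : ℕ) (x ξ : ℝ) :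
    pdXxi k l (fun x ξ => f x ξ * g x ξ) x ξ =
      ∑ j ∈ Finset.range (l + 1), (l.choose j : ℝ) * ∑ i ∈ Finset.range (k + 1), (k.choose i : ℝ) *
        (pdXxi i j f x ξ * pdXxi (k - i) (l - j) g x ξ) := by
  have h1 : ∀ x', iteratedDeriv l (fun ξ => f x' ξ * g x' ξ) ξ =
      ∑ j ∈ Finset.range (l + 1), (l.choose j : ℝ) *
        (iteratedDeriv j (f x') ξ * iteratedDeriv (l - j) (g x') ξ) := by
    intro x'
    have := iteratedDeriv_mul (n := l) (x := ξ) (f := f x') (g := g x')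
      ((hf.right x').contDiffAt.of_le (by exact_mod_cast le_top))
      ((hg.right x').contDiffAt.of_le (by exact_mod_cast le_top))
    simp only [mul_assoc] at this
    exact this
  unfold pdXxi
  simp only [h1]
  rw [iteratedDeriv_fun_sum]
  · refine Finset.sum_congr rfl fun j _ => ?_
    rw [iteratedDeriv_const_mul_field]
    congr 1
    have := iteratedDeriv_mul (n := k) (x := x) (f := fun x' => iteratedDeriv j (f x') ξ)
      (g := fun x' => iteratedDeriv (l - j) (g x') ξ)
      (((hf.iter j).left ξ).contDiffAt.of_le (by exact_mod_cast le_top))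
      (((hg.iter (l - j)).left ξ).contDiffAt.of_le (by exact_mod_cast le_top))
    simp only [mul_assoc] at this
    exact this
  · intro j _
    have := ((SM.const (l.choose j : ℝ)).mul ((hf.iter j).mul (hg.iter (l - j)))).left ξ
    exact this.contDiffAt.of_le (by exact_mod_cast le_top)

lemma pd_const (c : ℝ) (k l : ℕ) (x ξ : ℝ) :
    pdXxi k l (fun _ _ => c) x ξ = if k = 0 ∧ l = 0 then c else 0 := by
  unfold pdXxi
  simp only [iteratedDeriv_const]
  split_ifs <;> simp_all

lemma pd_const_mul (c : ℝ) (f : ℝ → ℝ → ℝ) (k l : ℕ) (x ξ : ℝ) :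
    pdXxi k l (fun x ξ => c * f x ξ) x ξ = c * pdXxi k l f x ξ := by
  unfold pdXxi
  simp only [iteratedDeriv_const_mul_field]

/-- the truncated majorant norm -/
noncomputable def JN (k l : ℕ) (r ρ x ξ : ℝ) (f : ℝ → ℝ → ℝ) : ℝ :=
  ∑ j ∈ Finset.range (l + 1), ∑ i ∈ Finset.range (k + 1),
    |pdXxi i j f x ξ| * (r ^ i / i.factorial) * (ρ ^ j / j.factorial)

section
variable {k l : ℕ} {r ρ x ξ : ℝ}

lemma JN_nonneg (hr : 0 ≤ r) (hρ : 0 ≤ ρ) (f : ℝ → ℝ → ℝ) : 0 ≤ JN k l r ρ x ξ f := by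
  unfold JN; positivity

lemma JN_add (hr : 0 ≤ r) (hρ : 0 ≤ ρ) {f g : ℝ → ℝ → ℝ} (hf : SM f) (hg : SM g) :
    JN k l r ρ x ξ (fun x ξ => f x ξ + g x ξ) ≤ JN k l r ρ x ξ f + JN k l r ρ x ξ g := by
  unfold JN
  rw [← Finset.sum_add_distrib]
  refine Finset.sum_le_sum fun j _ => ?_
  rw [← Finset.sum_add_distrib]
  refine Finset.sum_le_sum fun i _ => ?_
  rw [pd_add hf hg, ← add_mul, ← add_mul]
  gcongr
  exact abs_add_le _ _

lemma JN_const_mul (c : ℝ) (f : ℝ → ℝ → ℝ) :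
    JN k l r ρ x ξ (fun x ξ => c * f x ξ) = |c| * JN k l r ρ x ξ f := by
  unfold JN
  simp only [Finset.mul_sum, pd_const_mul, abs_mul, mul_assoc]

lemma JN_const (c : ℝ) : JN k l r ρ x ξ (fun _ _ => c) = |c| := by
  unfold JN
  rw [Finset.sum_eq_single 0, Finset.sum_eq_single 0]
  · simp [pd_const]
  · intro i _ hi; simp [pd_const, hi]
  · simp
  · intro j _ hj; simp [pd_const, hj]
  · simp

lemma conv_sum_le (k : ℕ) (F : ℕ → ℕ → ℝ) (hF : ∀ p q, 0 ≤ F p q) :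
    ∑ i ∈ Finset.range (k + 1), ∑ p ∈ Finset.range (i + 1), F p (i - p) ≤
      ∑ p ∈ Finset.range (k + 1), ∑ q ∈ Finset.range (k + 1), F p q := by
  rw [Finset.sum_comm' (t' := Finset.range (k + 1)) (s' := fun p => Finset.Ico p (k + 1))]
  · refine Finset.sum_le_sum fun p _ => ?_
    rw [Finset.sum_Ico_eq_sum_range]
    simp only [Nat.add_sub_cancel_left]
    exact Finset.sum_le_sum_of_subset_of_nonneg
      (fun q hq => by simp only [Finset.mem_range] at *; omega) (fun _ _ _ => hF _ _)
  · intro a b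
    simp only [Finset.mem_range, Finset.mem_Ico]; omega

lemma choose_aux (k i : ℕ) (hi : i ≤ k) (r : ℝ) :
    (k.choose i : ℝ) * (r ^ k / k.factorial) =
      (r ^ i / i.factorial) * (r ^ (k - i) / (k - i).factorial) := by
  rw [Nat.cast_choose ℝ hi]
  have : r ^ k = r ^ i * r ^ (k - i) := by rw [← pow_add]; congr 1; omega
  rw [this]
  have h1 := Nat.cast_ne_zero (R := ℝ).2 (Nat.factorial_ne_zero k)
  field_simp

/-- one term of the majorant norm -/
noncomputable def JT (r ρ x ξ : ℝ) (f : ℝ → ℝ → ℝ) (i j : ℕ) : ℝ :=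
  |pdXxi i j f x ξ| * (r ^ i / i.factorial) * (ρ ^ j / j.factorial)

lemma JT_mul (hr : 0 ≤ r) (hρ : 0 ≤ ρ) {f g : ℝ → ℝ → ℝ} (hf : SM f) (hg : SM g) (i j : ℕ) :
    JT r ρ x ξ (fun x ξ => f x ξ * g x ξ) i j ≤
      ∑ j' ∈ Finset.range (j + 1), ∑ i' ∈ Finset.range (i + 1),
        JT r ρ x ξ f i' j' * JT r ρ x ξ g (i - i') (j - j') := by
  unfold JT
  rw [pd_mul hf hg]
  calc _ ≤ (∑ j' ∈ Finset.range (j + 1), ∑ i' ∈ Finset.range (i + 1), (j.choose j' : ℝ) *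
            ((i.choose i' : ℝ) *
            (|pdXxi i' j' f x ξ| * |pdXxi (i - i') (j - j') g x ξ|))) *
            (r ^ i / i.factorial) * (ρ ^ j / j.factorial) := by
        gcongr
        refine (Finset.abs_sum_le_sum_abs _ _).trans (Finset.sum_le_sum fun j' _ => ?_)
        rw [Finset.mul_sum]
        refine (Finset.abs_sum_le_sum_abs _ _).trans (Finset.sum_le_sum fun i' _ => ?_)
        simp [abs_mul]
    _ = _ := by
        rw [Finset.sum_mul, Finset.sum_mul]
        refine Finset.sum_congr rfl fun j' hj' => ?_
        rw [Finset.sum_mul, Finset.sum_mul]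
        refine Finset.sum_congr rfl fun i' hi' => ?_
        have e1 := choose_aux i i' (by simp at hi'; omega) r
        have e2 := choose_aux j j' (by simp at hj'; omega) ρ
        calc _ = ((i.choose i' : ℝ) * (r ^ i / i.factorial)) *
              ((j.choose j' : ℝ) * (ρ ^ j / j.factorial)) *
              (|pdXxi i' j' f x ξ| * |pdXxi (i - i') (j - j') g x ξ|) := by ring
          _ = _ := by rw [e1, e2]; ring

lemma conv2_sum_le (k l : ℕ) (cf cg : ℕ → ℕ → ℝ) (hcf : ∀ i j, 0 ≤ cf i j)
    (hcg : ∀ i j, 0 ≤ cg i j) :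
    ∑ j ∈ Finset.range (l + 1), ∑ i ∈ Finset.range (k + 1),
        ∑ j' ∈ Finset.range (j + 1), ∑ i' ∈ Finset.range (i + 1),
        cf i' j' * cg (i - i') (j - j') ≤
    (∑ j ∈ Finset.range (l + 1), ∑ i ∈ Finset.range (k + 1), cf i j) *
    (∑ j ∈ Finset.range (l + 1), ∑ i ∈ Finset.range (k + 1), cg i j) := by
  have e1 := conv_sum_le l (fun p q => ∑ i ∈ Finset.range (k + 1), ∑ i' ∈ Finset.range (i + 1),
        cf i' p * cg (i - i') q) (fun p q => Finset.sum_nonneg fun _ _ => Finset.sum_nonneg fun _ _ =>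
          mul_nonneg (hcf _ _) (hcg _ _))
  have e2 : ∀ p q, ∑ i ∈ Finset.range (k + 1), ∑ i' ∈ Finset.range (i + 1),
        cf i' p * cg (i - i') q ≤ (∑ i ∈ Finset.range (k + 1), cf i p) *
          (∑ i ∈ Finset.range (k + 1), cg i q) := by
    intro p q
    rw [Finset.sum_mul_sum]
    exact conv_sum_le k (fun m n => cf m p * cg n q) (fun _ _ => mul_nonneg (hcf _ _) (hcg _ _))
  have e3 : ∀ j, ∑ i ∈ Finset.range (k + 1),
        ∑ j' ∈ Finset.range (j + 1), ∑ i' ∈ Finset.range (i + 1),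
        cf i' j' * cg (i - i') (j - j') = ∑ j' ∈ Finset.range (j + 1), ∑ i ∈ Finset.range (k + 1),
        ∑ i' ∈ Finset.range (i + 1), cf i' j' * cg (i - i') (j - j') := fun j => Finset.sum_comm
  rw [Finset.sum_congr rfl fun j _ => e3 j]
  refine e1.trans ?_
  rw [Finset.sum_mul_sum]
  exact Finset.sum_le_sum fun p _ => Finset.sum_le_sum fun q _ => e2 p q

lemma JN_mul (hr : 0 ≤ r) (hρ : 0 ≤ ρ) {f g : ℝ → ℝ → ℝ} (hf : SM f) (hg : SM g) :
    JN k l r ρ x ξ (fun x ξ => f x ξ * g x ξ) ≤ JN k l r ρ x ξ f * JN k l r ρ x ξ g := by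
  have hc : ∀ f i j, 0 ≤ JT r ρ x ξ f i j := fun f i j => by unfold JT; positivity
  have h := conv2_sum_le k l (JT r ρ x ξ f) (JT r ρ x ξ g) (hc f) (hc g)
  refine le_trans ?_ h
  exact Finset.sum_le_sum fun j _ => Finset.sum_le_sum fun i _ => JT_mul hr hρ hf hg i j

lemma JN_pow (hr : 0 ≤ r) (hρ : 0 ≤ ρ) {f : ℝ → ℝ → ℝ} (hf : SM f) (n : ℕ) :
    JN k l r ρ x ξ (fun x ξ => f x ξ ^ n) ≤ JN k l r ρ x ξ f ^ n := by
  induction n with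
  | zero => simp [JN_const]
  | succ n ih =>
    simp only [pow_succ]
    refine (JN_mul hr hρ (hf.pow n) hf).trans ?_
    exact mul_le_mul_of_nonneg_right ih (JN_nonneg hr hρ f)

lemma JN_sum (hr : 0 ≤ r) (hρ : 0 ≤ ρ) {f : ℕ → ℝ → ℝ → ℝ} (hf : ∀ n, SM (f n)) (n : ℕ) :
    JN k l r ρ x ξ (fun x ξ => ∑ m ∈ Finset.range n, f m x ξ) ≤
      ∑ m ∈ Finset.range n, JN k l r ρ x ξ (f m) := by
  induction n with
  | zero => simp [JN_const]
  | succ n ih =>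
    simp only [Finset.sum_range_succ]
    refine (JN_add hr hρ (SM.sum _ fun i _ => hf i) (hf n)).trans ?_
    gcongr

lemma JN_single (hr : 0 ≤ r) (hρ : 0 ≤ ρ) (f : ℝ → ℝ → ℝ) :
    |pdXxi k l f x ξ| * (r ^ k / k.factorial) * (ρ ^ l / l.factorial) ≤ JN k l r ρ x ξ f := by
  unfold JN
  refine le_trans ?_ (Finset.single_le_sum (f := fun j => ∑ i ∈ Finset.range (k + 1),
    |pdXxi i j f x ξ| * (r ^ i / i.factorial) * (ρ ^ j / j.factorial)) (fun j _ => by positivity)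
    (Finset.self_mem_range_succ l))
  exact Finset.single_le_sum (f := fun i =>
    |pdXxi i l f x ξ| * (r ^ i / i.factorial) * (ρ ^ l / l.factorial)) (fun j _ => by positivity)
    (Finset.self_mem_range_succ k)

end

/-- `h m` is the `m`-th derivative of `h 0` on the positive half line -/
def DChain (h : ℕ → ℝ → ℝ) : Prop := ∀ m y, 0 < y → HasDerivAt (h m) (h (m + 1) y) y

lemma DChain.shift {h : ℕ → ℝ → ℝ} (hh : DChain h) : DChain (fun m => h (m + 1)) :=
  fun m y hy => hh (m + 1) y hy

lemma DChain.contDiffOn {h : ℕ → ℝ → ℝ} (hh : DChain h) : ContDiffOn ℝ ∞ (h 0) (Ioi 0) := by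
  have : ∀ n : ℕ, ∀ m, ContDiffOn ℝ n (h m) (Ioi 0) := by
    intro n
    induction n with
    | zero =>
      intro m
      simp only [Nat.cast_zero, contDiffOn_zero]
      exact fun y hy => (hh m y hy).continuousAt.continuousWithinAt
    | succ n ih =>
      intro m
      rw [Nat.cast_add, Nat.cast_one, contDiffOn_succ_iff_deriv_of_isOpen isOpen_Ioi]
      refine ⟨fun y hy => (hh m y hy).differentiableAt.differentiableWithinAt, by simp, ?_⟩
      exact (ih (m + 1)).congr fun y hy => (hh m y hy).deriv
  exact contDiffOn_infty.2 fun n => this n 0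

lemma DChain.comp {h : ℕ → ℝ → ℝ} (hh : DChain h) {f : ℝ → ℝ → ℝ} (hf : SM f)
    (hpos : ∀ x ξ, 0 < f x ξ) : SM (fun x ξ => h 0 (f x ξ)) :=
  hh.contDiffOn.comp_contDiff hf (fun p => hpos p.1 p.2)

lemma pd_vanish {f : ℝ → ℝ → ℝ} (hf : SM f) (hpos : ∀ x ξ, 0 < f x ξ) (x ξ : ℝ) (k l : ℕ) :
    ∀ (h : ℕ → ℝ → ℝ) (g : ℝ → ℝ → ℝ), DChain h → SM g → (∀ m ≤ k + l, h m (f x ξ) = 0) →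
      pdXxi k l (fun x ξ => g x ξ * h 0 (f x ξ)) x ξ = 0 := by
  induction l with
  | zero =>
    induction k with
    | zero =>
      intro h g _ _ h0
      simp [pdXxi, h0]
    | succ k ih =>
      intro h g hh hg h0
      have e : pdXxi (k + 1) 0 (fun x ξ => g x ξ * h 0 (f x ξ)) x ξ =
          pdXxi k 0 (fun x ξ => Dx g x ξ * h 0 (f x ξ) +
            (g x ξ * Dx f x ξ) * h 1 (f x ξ)) x ξ := by
        simp only [pdXxi, iteratedDeriv_zero, iteratedDeriv_succ']
        congr 1
        ext x'
        have h1 := ((hg.left ξ).differentiable (by simp) x').hasDerivAt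
        have h2 := ((hf.left ξ).differentiable (by simp) x').hasDerivAt
        have h3 := (hh 0 (f x' ξ) (hpos _ _)).comp x' h2
        have h4 := (h1.mul h3).deriv
        simp only [Dx]
        refine Eq.trans h4 ?_
        simp only [Function.comp]
        ring
      rw [e, pd_add (hg.Dx.mul (hh.comp hf hpos)) ((hg.mul hf.Dx).mul (hh.shift.comp hf hpos)),
        ih h _ hh hg.Dx (fun m hm => h0 m (by omega)),
        ih _ _ hh.shift (hg.mul hf.Dx) (fun m hm => h0 (m + 1) (by omega))]
      simp
  | succ l ih =>
    intro h g hh hg h0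
    have e : pdXxi k (l + 1) (fun x ξ => g x ξ * h 0 (f x ξ)) x ξ =
        pdXxi k l (fun x ξ => Dxi g x ξ * h 0 (f x ξ) +
          (g x ξ * Dxi f x ξ) * h 1 (f x ξ)) x ξ := by
      simp only [pdXxi, iteratedDeriv_succ']
      congr 1
      ext x'
      congr 1
      ext ξ'
      have h1 := ((hg.right x').differentiable (by simp) ξ').hasDerivAt
      have h2 := ((hf.right x').differentiable (by simp) ξ').hasDerivAt
      have h3 := (hh 0 (f x' ξ') (hpos _ _)).comp ξ' h2
      have h4 := (h1.mul h3).deriv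
      simp only [Dxi]
      refine Eq.trans h4 ?_
      simp only [Function.comp]
      ring
    rw [e, pd_add (hg.Dxi.mul (hh.comp hf hpos)) ((hg.mul hf.Dxi).mul (hh.shift.comp hf hpos)),
      ih h _ hh hg.Dxi (fun m hm => h0 m (by omega)),
      ih _ _ hh.shift (hg.mul hf.Dxi) (fun m hm => h0 (m + 1) (by omega))]
    simp

lemma JN_comp {k l : ℕ} {r ρ x ξ : ℝ} (hr : 0 ≤ r) (hρ : 0 ≤ ρ) {f : ℝ → ℝ → ℝ} (hf : SM f)
    (hpos : ∀ x ξ, 0 < f x ξ) {h : ℕ → ℝ → ℝ} (hh : DChain h) (M θ : ℝ)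
    (hM : ∀ m, |h m (f x ξ)| * f x ξ ^ m ≤ m.factorial * M) (hθ : θ ≤ 1 / 2)
    (hJ : JN k l r ρ x ξ (fun x' ξ' => f x' ξ' - f x ξ) ≤ θ * f x ξ) :
    JN k l r ρ x ξ (fun x' ξ' => h 0 (f x' ξ') - h 0 (f x ξ)) ≤ 2 * θ * M := by
  set y := f x ξ with hy
  have hy0 : 0 < y := hpos _ _
  have hM0 : 0 ≤ M := by
    have := hM 0
    simp at this
    exact (abs_nonneg _).trans this
  have hθ0 : 0 ≤ θ := by
    have := (JN_nonneg hr hρ _).trans hJ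
    exact nonneg_of_mul_nonneg_left this hy0
  set N := k + l with hN
  let P : ℝ → ℝ := fun z => ∑ i ∈ Finset.range (N + 1), h i y / i.factorial * (z - y) ^ i
  have hP : ContDiff ℝ ∞ P := by
    refine ContDiff.sum fun i _ => ?_
    fun_prop
  let K : ℕ → ℝ → ℝ := fun m z => h m z - iteratedDeriv m P z
  have hK : DChain K := by
    intro m z hz
    refine (hh m z hz).sub ?_
    rw [iteratedDeriv_succ]
    exact ((hP.differentiable_iteratedDeriv m (by exact_mod_cast ENat.natCast_lt_top m)) z).hasDerivAt
  have hPm : ∀ m ≤ N, iteratedDeriv m P y = h m y := by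
    intro m hm
    simp only [P]
    rw [iteratedDeriv_fun_sum (fun i _ => by fun_prop)]
    have : ∀ i ∈ Finset.range (N + 1),
        iteratedDeriv m (fun z => h i y / i.factorial * (z - y) ^ i) y =
        if m = i then h i y else 0 := by
      intro i _
      rw [iteratedDeriv_const_mul_field,
        iteratedDeriv_comp_sub_const (f := fun z : ℝ => z ^ i)]
      simp only [sub_self, iteratedDeriv_fun_pow_zero]
      split_ifs
      · have := Nat.cast_ne_zero (R := ℝ).2 (Nat.factorial_ne_zero i)
        field_simp
      · simp
    rw [Finset.sum_congr rfl this, Finset.sum_ite_eq]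
    simp [hm]
  have hKv : ∀ i j, i ≤ k → j ≤ l → pdXxi i j (fun x ξ => K 0 (f x ξ)) x ξ = 0 := by
    intro i j hi hj
    have := pd_vanish hf hpos x ξ i j K (fun _ _ => 1) hK (SM.const 1)
      (fun m hm => by simp only [K]; rw [← hy, hPm m (by omega), sub_self])
    simpa using this
  have hJK : JN k l r ρ x ξ (fun x ξ => K 0 (f x ξ)) = 0 := by
    unfold JN
    refine Finset.sum_eq_zero fun j hj => Finset.sum_eq_zero fun i hi => ?_
    rw [hKv i j (by simp at hi; omega) (by simp at hj; omega)]
    simp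
  have hfs : SM (fun x' ξ' => f x' ξ' - y) := hf.sub (SM.const y)
  have hterm : ∀ i, SM (fun x' ξ' => h (i + 1) y / (i + 1).factorial * (f x' ξ' - y) ^ (i + 1)) :=
    fun i => (SM.const _).mul (hfs.pow _)
  have e : (fun x' ξ' => h 0 (f x' ξ') - h 0 y) = fun x' ξ' => K 0 (f x' ξ') +
      ∑ i ∈ Finset.range N, h (i + 1) y / (i + 1).factorial * (f x' ξ' - y) ^ (i + 1) := by
    ext x' ξ'
    simp only [K, P, iteratedDeriv_zero]
    rw [Finset.sum_range_succ']
    simp only [Nat.factorial_zero, Nat.cast_one, div_one, pow_zero, mul_one]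
    ring
  rw [e]
  refine (JN_add hr hρ (hK.comp hf hpos) (SM.sum _ fun i _ => hterm i)).trans ?_
  rw [hJK, zero_add]
  refine (JN_sum hr hρ hterm N).trans ?_
  have hb : ∀ i ∈ Finset.range N, JN k l r ρ x ξ
      (fun x' ξ' => h (i + 1) y / (i + 1).factorial * (f x' ξ' - y) ^ (i + 1)) ≤
      M * θ * (1 / 2) ^ i := by
    intro i _
    rw [JN_const_mul]
    have hfac : (0:ℝ) < (i + 1).factorial := by exact_mod_cast Nat.factorial_pos _
    calc _ ≤ |h (i + 1) y / (i + 1).factorial| * (θ * y) ^ (i + 1) := by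
          gcongr
          refine (JN_pow hr hρ hfs (i + 1)).trans ?_
          exact pow_le_pow_left₀ (JN_nonneg hr hρ _) hJ _
      _ = (|h (i + 1) y| * y ^ (i + 1)) / (i + 1).factorial * θ ^ (i + 1) := by
          rw [abs_div, abs_of_pos hfac]; ring
      _ ≤ M * θ ^ (i + 1) := by
          gcongr
          rw [div_le_iff₀ hfac]
          linarith [hM (i + 1)]
      _ = M * θ * θ ^ i := by ring
      _ ≤ M * θ * (1 / 2) ^ i := by gcongr
  refine (Finset.sum_le_sum hb).trans ?_
  rw [← Finset.mul_sum]
  have hg : ∑ i ∈ Finset.range N, ((1:ℝ) / 2) ^ i ≤ 2 := sum_geometric_two_le N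
  calc _ ≤ M * θ * 2 := by gcongr
    _ = _ := by ring

lemma JN_right {k l : ℕ} {r ρ x ξ : ℝ} (g : ℝ → ℝ) :
    JN k l r ρ x ξ (fun _ ξ' => g ξ') =
      ∑ j ∈ Finset.range (l + 1), |iteratedDeriv j g ξ| * (ρ ^ j / j.factorial) := by
  unfold JN
  refine Finset.sum_congr rfl fun j _ => ?_
  rw [Finset.sum_eq_single 0]
  · simp [pdXxi]
  · intro i _ hi
    simp [pdXxi, iteratedDeriv_const, hi]
  · simp

lemma JN_left {k l : ℕ} {r ρ x ξ : ℝ} (g : ℝ → ℝ) :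
    JN k l r ρ x ξ (fun x' _ => g x') =
      ∑ i ∈ Finset.range (k + 1), |iteratedDeriv i g x| * (r ^ i / i.factorial) := by
  unfold JN
  rw [Finset.sum_eq_single 0]
  · simp [pdXxi]
  · intro j _ hj
    simp [pdXxi, iteratedDeriv_const, hj]
  · simp

lemma JN_id {k l : ℕ} {r ρ x ξ : ℝ} (hρ : 0 ≤ ρ) :
    JN k l r ρ x ξ (fun _ ξ' => ξ' - ξ) ≤ ρ := by
  rw [JN_right (fun ξ' => ξ' - ξ)]
  have : ∀ j ∈ Finset.range (l + 1), |iteratedDeriv j (fun ξ' => ξ' - ξ) ξ| * (ρ ^ j / j.factorial)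
      = if j = 1 then ρ else 0 := by
    intro j _
    rw [iteratedDeriv_comp_sub_const (f := fun z : ℝ => z)]
    simp only [sub_self, iteratedDeriv_fun_id_zero]
    split_ifs with h
    · subst h; simp
    · simp
  rw [Finset.sum_congr rfl this, Finset.sum_ite_eq']
  split_ifs <;> simp [hρ]

noncomputable def rpowChain (δ : ℝ) (m : ℕ) (y : ℝ) : ℝ :=
  (descPochhammer ℝ m).eval δ * y ^ (δ - m)

lemma rpowChain_chain (δ : ℝ) : DChain (rpowChain δ) := by
  intro m y hy
  unfold rpowChain
  have := (Real.hasDerivAt_rpow_const (x := y) (p := δ - m) (Or.inl hy.ne')).const_mul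
    ((descPochhammer ℝ m).eval δ)
  refine this.congr_deriv ?_
  simp only [descPochhammer_succ_right, Polynomial.eval_mul, Polynomial.eval_sub, Polynomial.eval_X,
    Polynomial.eval_natCast]
  push_cast
  rw [← sub_sub]
  ring

lemma descPochhammer_abs_le (δ : ℝ) (h0 : 0 ≤ δ) (h1 : δ ≤ 1) (m : ℕ) :
    |(descPochhammer ℝ m).eval δ| ≤ m.factorial := by
  induction m with
  | zero => simp
  | succ m ih =>
    simp only [descPochhammer_succ_right, Polynomial.eval_mul, Polynomial.eval_sub,
      Polynomial.eval_X, Polynomial.eval_natCast, abs_mul, Nat.factorial_succ]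
    push_cast
    rw [mul_comm]
    gcongr
    rw [abs_le]
    have : (0:ℝ) ≤ m := Nat.cast_nonneg m
    constructor <;> linarith

lemma JN_W {k l : ℕ} {r ε x ξ c δ : ℝ} (hr : 0 ≤ r) (hε : 0 ≤ ε) (hε1 : ε ≤ 1 / 25)
    (hc : 0 < c) (hδ0 : 0 ≤ δ) (hδ1 : δ ≤ 1) :
    JN k l r (ε * Real.sqrt (c + ξ ^ 2)) x ξ
      (fun _ ξ' => (c + ξ' ^ 2) ^ δ - (c + ξ ^ 2) ^ δ) ≤ 1 / 5 * (c + ξ ^ 2) ^ δ := by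
  set w := Real.sqrt (c + ξ ^ 2) with hw
  have hw2 : w ^ 2 = c + ξ ^ 2 := Real.sq_sqrt (by positivity)
  have hw0 : 0 ≤ w := Real.sqrt_nonneg _
  have hρ : 0 ≤ ε * w := by positivity
  have hid : SM (fun _ ξ' => ξ' - ξ) := by unfold SM; fun_prop
  have hu : SM (fun _ ξ' => c + ξ' ^ 2) := by unfold SM; fun_prop
  have hξw : |ξ| ≤ w := by
    rw [← Real.sqrt_sq_eq_abs]; exact Real.sqrt_le_sqrt (by linarith)
  have hJ : JN k l r (ε * w) x ξ (fun _ ξ' => (c + ξ' ^ 2) - (c + ξ ^ 2)) ≤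
      1 / 10 * (c + ξ ^ 2) := by
    have e : (fun (_ : ℝ) ξ' => (c + ξ' ^ 2) - (c + ξ ^ 2)) =
        fun _ ξ' => (ξ' - ξ) ^ 2 + (2 * ξ) * (ξ' - ξ) := by
      ext _ ξ'; ring
    rw [e]
    refine (JN_add hr hρ (hid.pow 2) ((SM.const _).mul hid)).trans ?_
    rw [JN_const_mul (2 * ξ) (fun _ ξ' => ξ' - ξ)]
    have h1 := JN_id (k := k) (l := l) (r := r) (x := x) (ξ := ξ) hρ
    have h0 := JN_nonneg (k := k) (l := l) (x := x) (ξ := ξ) hr hρ (fun _ ξ' => ξ' - ξ)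
    have h2 := (JN_pow (k := k) (l := l) (x := x) (ξ := ξ) hr hρ hid 2).trans
      (pow_le_pow_left₀ h0 h1 2)
    calc _ ≤ (ε * w) ^ 2 + (2 * w) * (ε * w) := by
          refine add_le_add h2 ?_
          rw [abs_mul, abs_two]
          gcongr
      _ = (ε ^ 2 + 2 * ε) * w ^ 2 := by ring
      _ ≤ 1 / 10 * w ^ 2 := by gcongr; nlinarith
      _ = _ := by rw [hw2]
  have hu0 : ∀ ξ : ℝ, 0 < c + ξ ^ 2 := fun ξ => by positivity
  have := JN_comp (k := k) (l := l) (x := x) (ξ := ξ) hr hρ hu (fun _ ξ => hu0 ξ)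
    (rpowChain_chain δ) ((c + ξ ^ 2) ^ δ) (1 / 10) (by
      intro m
      unfold rpowChain
      rw [abs_mul, mul_assoc, abs_of_pos (Real.rpow_pos_of_pos (hu0 ξ) _),
        ← Real.rpow_natCast (c + ξ ^ 2) m, ← Real.rpow_add (hu0 ξ), sub_add_cancel]
      gcongr
      exact descPochhammer_abs_le δ hδ0 hδ1 m) (by norm_num) hJ
  simp only [rpowChain, descPochhammer_zero, Polynomial.eval_one, one_mul, Nat.cast_zero,
    sub_zero] at this
  refine this.trans (le_of_eq (by ring))

/-- derivatives of `y / (b y + 1)` -/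
noncomputable def GF (m : ℕ) (b y : ℝ) : ℝ :=
  match m with
  | 0 => y / (b * y + 1)
  | m + 1 => (m + 1).factorial * (-b) ^ m / (b * y + 1) ^ (m + 2)

lemma GF_deriv (m : ℕ) {b y : ℝ} (hb : 0 ≤ b) (hy : 0 < y) :
    HasDerivAt (fun y => GF m b y) (GF (m + 1) b y) y := by
  have hp : 0 < b * y + 1 := by positivity
  have hlin : HasDerivAt (fun y => b * y + 1) b y := by
    simpa using ((hasDerivAt_id y).const_mul b).add_const 1
  cases m with
  | zero =>
    simp only [GF]
    refine ((hasDerivAt_id y).div hlin hp.ne').congr_deriv ?_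
    simp
    ring
  | succ m =>
    simp only [GF]
    refine ((hasDerivAt_const y ((m + 1).factorial * (-b) ^ m : ℝ)).div (hlin.fun_pow (m + 2))
      (pow_pos hp _).ne').congr_deriv ?_
    rw [Nat.factorial_succ (m + 1)]
    push_cast
    rw [div_eq_div_iff (pow_pos (pow_pos hp _) _).ne' (pow_pos hp _).ne']
    ring

lemma GF_bound (m : ℕ) {b y : ℝ} (hb : 0 ≤ b) (hy : 0 < y) :
    |GF m b y| * y ^ m ≤ m.factorial * GF 0 b y := by
  have hp : 0 < b * y + 1 := by positivity
  cases m with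
  | zero =>
    simp only [GF, pow_zero, mul_one, Nat.factorial_zero, Nat.cast_one, one_mul]
    rw [abs_of_nonneg (by positivity)]
  | succ m =>
    simp only [GF]
    rw [abs_div, abs_mul, abs_pow, abs_neg, abs_of_nonneg hb, Nat.abs_cast,
      abs_of_pos (pow_pos hp _), div_mul_eq_mul_div, mul_assoc, mul_div_assoc]
    refine mul_le_mul_of_nonneg_left ?_ (Nat.cast_nonneg _)
    rw [div_le_div_iff₀ (pow_pos hp _) hp]
    have h1 : (b * y) ^ m ≤ (b * y + 1) ^ m := by gcongr; linarith
    calc b ^ m * y ^ (m + 1) * (b * y + 1) = (b * y) ^ m * (y * (b * y + 1)) := by ring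
      _ ≤ (b * y + 1) ^ m * (y * ((b * y + 1) * (b * y + 1))) := by
          gcongr
          have : 0 ≤ b * y := by positivity
          nlinarith
      _ = _ := by ring

lemma GF_dom (m : ℕ) {b y : ℝ} (hb : 0 ≤ b) (hy : 0 < y) :
    |GF (m + 1) b y| ≤ (m + 1).factorial * b ^ m := by
  have hp : 1 ≤ b * y + 1 := by have : 0 ≤ b * y := by positivity
                                linarith
  simp only [GF]
  rw [abs_div, abs_mul, abs_pow, abs_neg, abs_of_nonneg hb, Nat.abs_cast,
      abs_of_pos (by positivity)]
  exact div_le_self (by positivity) (one_le_pow₀ hp)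

lemma GF_cont (m : ℕ) {y : ℝ} (hy : 0 < y) {S : Set ℝ} {b : ℝ → ℝ} (hb : ContinuousOn b S)
    (hb0 : ∀ t ∈ S, 0 ≤ b t) : ContinuousOn (fun σ => GF m (b σ) y) S := by
  have hp : ∀ t ∈ S, b t * y + 1 ≠ 0 := fun t ht => by
    have := hb0 t ht; positivity
  cases m with
  | zero =>
    simp only [GF]
    exact continuousOn_const.div (by fun_prop) hp
  | succ m =>
    simp only [GF]
    exact ContinuousOn.div (by fun_prop) (by fun_prop) (fun t ht => pow_ne_zero _ (hp t ht))

lemma int_chain {T t : ℝ} {b β : ℝ → ℝ} (ht : t ∈ Icc (0:ℝ) T) (hb : ContinuousOn b (Icc 0 T))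
    (hb0 : ∀ t ∈ Icc (0:ℝ) T, 0 ≤ b t) (hβ : ContinuousOn β (Icc 0 T)) :
    DChain (fun m y => ∫ σ in (0:ℝ)..t, β σ * GF m (b σ) y) := by
  intro m y hy
  have hsub : Set.uIcc 0 t ⊆ Icc 0 T := by
    rw [Set.uIcc_of_le ht.1]; exact Icc_subset_Icc_right ht.2
  have hsub' : Set.uIoc 0 t ⊆ Icc 0 T := Set.uIoc_subset_uIcc.trans hsub
  have hIntg : ∀ m, ∀ y, 0 < y → IntervalIntegrable (fun σ => β σ * GF m (b σ) y)
      MeasureTheory.volume 0 t := fun m y hy =>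
    ((hβ.mul (GF_cont m hy hb hb0)).mono hsub).intervalIntegrable
  refine (intervalIntegral.hasDerivAt_integral_of_dominated_loc_of_deriv_le
    (F := fun y σ => β σ * GF m (b σ) y) (F' := fun y σ => β σ * GF (m + 1) (b σ) y)
    (s := Ioi 0) (bound := fun σ => |β σ| * ((m + 1).factorial * b σ ^ m))
    (Ioi_mem_nhds hy) ?_ (hIntg m y hy) ?_ ?_ ?_ ?_).2
  · filter_upwards [Ioi_mem_nhds hy] with z hz
    exact (intervalIntegrable_iff.1 (hIntg m z hz)).aestronglyMeasurable
  · exact (intervalIntegrable_iff.1 (hIntg (m + 1) y hy)).aestronglyMeasurable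
  · refine Filter.Eventually.of_forall fun σ hσ z hz => ?_
    rw [Real.norm_eq_abs, abs_mul]
    gcongr
    exact GF_dom m (hb0 σ (hsub' hσ)) hz
  · refine ContinuousOn.intervalIntegrable (ContinuousOn.mono ?_ hsub)
    fun_prop
  · refine Filter.Eventually.of_forall fun σ hσ z hz => ?_
    exact (GF_deriv m (hb0 σ (hsub' hσ)) hz).const_mul _

lemma int_bound {T t : ℝ} {b β : ℝ → ℝ} (ht : t ∈ Icc (0:ℝ) T) (hb : ContinuousOn b (Icc 0 T))
    (hb0 : ∀ t ∈ Icc (0:ℝ) T, 0 ≤ b t) (hβ : ContinuousOn β (Icc 0 T)) (hβ0 : ∀ σ, 0 ≤ β σ)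
    (m : ℕ) {y : ℝ} (hy : 0 < y) :
    |∫ σ in (0:ℝ)..t, β σ * GF m (b σ) y| * y ^ m ≤
      m.factorial * ∫ σ in (0:ℝ)..t, β σ * GF 0 (b σ) y := by
  have hsub : Set.uIcc 0 t ⊆ Icc 0 T := by
    rw [Set.uIcc_of_le ht.1]; exact Icc_subset_Icc_right ht.2
  have hIntg : ∀ m, IntervalIntegrable (fun σ => β σ * GF m (b σ) y)
      MeasureTheory.volume 0 t := fun m =>
    ((hβ.mul (GF_cont m hy hb hb0)).mono hsub).intervalIntegrable
  rw [← abs_of_pos (pow_pos hy m), ← abs_mul, ← intervalIntegral.integral_mul_const,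
    ← intervalIntegral.integral_const_mul]
  refine (intervalIntegral.abs_integral_le_integral_abs ht.1).trans ?_
  refine intervalIntegral.integral_mono_on ht.1 ((hIntg m).mul_const _).abs
    ((hIntg 0).const_mul _) fun σ hσ => ?_
  have := GF_bound m (hb0 σ ⟨hσ.1, hσ.2.trans ht.2⟩) hy
  rw [abs_mul, abs_mul, abs_of_nonneg (hβ0 σ), abs_of_pos (pow_pos hy m), mul_assoc]
  calc _ ≤ β σ * (m.factorial * GF 0 (b σ) y) := mul_le_mul_of_nonneg_left this (hβ0 σ)
    _ = _ := by ring

lemma glaeser {a : ℝ → ℝ} (ha : ContDiff ℝ ∞ a) (ha0 : ∀ x, 0 ≤ a x) {M : ℝ}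
    (hM : ∀ x, |iteratedDeriv 2 a x| ≤ M) (x : ℝ) {c : ℝ} (hc : 0 ≤ c) :
    |iteratedDeriv 1 a x| * c ≤ a x + M * c ^ 2 := by
  have hM0 : 0 ≤ M := (abs_nonneg _).trans (hM x)
  rw [iteratedDeriv_one]
  have hd : Differentiable ℝ a := ha.differentiable (by simp)
  have hd2 : Differentiable ℝ (deriv a) := by
    have := ha.differentiable_iteratedDeriv 1 (by exact_mod_cast ENat.natCast_lt_top 1)
    rwa [iteratedDeriv_one] at this
  have h2 : ∀ x, ‖deriv (deriv a) x‖ ≤ M := by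
    intro x
    have := hM x
    rwa [iteratedDeriv_succ, iteratedDeriv_one] at this
  have hlip : ∀ y, |deriv a y - deriv a x| ≤ M * |y - x| := fun y =>
    Convex.norm_image_sub_le_of_norm_deriv_le (s := univ) (fun z _ => hd2 z) (fun z _ => h2 z)
      convex_univ (mem_univ _) (mem_univ _)
  have key : ∀ h : ℝ, |h| ≤ c → 0 ≤ a x + deriv a x * h + M * c ^ 2 := by
    intro h hh
    have hf : ∀ y, HasDerivAt (fun y => a y - deriv a x * y) (deriv a y - deriv a x) y := by
      intro y
      exact ((hd y).hasDerivAt.sub ((hasDerivAt_id y).const_mul (deriv a x))).congr_deriv (by simp)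
    have := Convex.norm_image_sub_le_of_norm_deriv_le (f := fun y => a y - deriv a x * y)
      (s := Metric.closedBall x c) (C := M * c) (x := x) (y := x + h)
      (fun z _ => (hf z).differentiableAt) (fun z hz => by
        rw [(hf z).deriv]
        refine (hlip z).trans ?_
        gcongr
        simpa [Real.dist_eq] using hz) (convex_closedBall x c) (by simpa using hc)
        (by simpa [Real.dist_eq] using hh)
    rw [Real.norm_eq_abs, Real.norm_eq_abs, abs_le] at this
    have h3 := this.2
    have h4 := ha0 (x + h)
    have h5 : M * c * |x + h - x| ≤ M * c * c := by
      gcongr; simpa using hh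
    nlinarith
  rcases abs_cases (deriv a x) with ⟨h, _⟩ | ⟨h, _⟩
  · have := key (-c) (by rw [abs_neg, abs_of_nonneg hc])
    rw [h]; linarith
  · have := key c (by rw [abs_of_nonneg hc])
    rw [h]; linarith

lemma fac_aux (j N : ℕ) (h : j + 2 ≤ N) : (j + 2).factorial ≤ 4 ^ (j + 2) * N ^ j := by
  have h1 : j.factorial ≤ N ^ j :=
    (Nat.factorial_le_pow j).trans (Nat.pow_le_pow_left (by omega) j)
  have h2 : (j + 2) * (j + 1) ≤ 4 ^ (j + 2) := by
    have h3 : j + 2 < 2 ^ (j + 2) := Nat.lt_two_pow_self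
    calc (j + 2) * (j + 1) ≤ 2 ^ (j + 2) * 2 ^ (j + 2) := Nat.mul_le_mul (by omega) (by omega)
      _ = 4 ^ (j + 2) := by rw [← mul_pow]; norm_num
  calc (j + 2).factorial = ((j + 2) * (j + 1)) * j.factorial := by
        rw [Nat.factorial_succ, Nat.factorial_succ]; ring
    _ ≤ _ := Nat.mul_le_mul h2 h1

lemma tail_term {C₀ A₀ s ε p d : ℝ} (hC : 0 < C₀) (hA : 0 < A₀) (hs : 1 < s) (hε : 0 ≤ ε)
    (hp : 0 < p) (j N : ℕ) (hj : j + 2 ≤ N)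
    (hd : |d| ≤ C₀ * A₀ ^ (j + 2) * ((j + 2).factorial : ℝ) ^ s) :
    |d| * ((ε * p / (1 + (N : ℝ) ^ (s - 1) * p)) ^ (j + 2) / (j + 2).factorial) ≤
      C₀ * (A₀ * (4:ℝ) ^ (s - 1) * ε) ^ (j + 2) * p ^ 2 := by
  set F : ℝ := ((j + 2).factorial : ℝ) with hF
  have hF0 : 0 < F := by rw [hF]; exact_mod_cast Nat.factorial_pos _
  set n : ℝ := (N : ℝ) ^ (s - 1) with hn
  have hn0 : 0 ≤ n := by positivity
  set D := 1 + n * p with hD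
  have hD1 : 1 ≤ D := by rw [hD]; have : 0 ≤ n * p := by positivity
                         linarith
  have hD0 : 0 < D := by linarith
  have hFs : F ^ s = F ^ (s - 1) * F := by
    rw [← Real.rpow_add_one hF0.ne']; congr 1; ring
  have hF1 : F ^ (s - 1) ≤ ((4:ℝ) ^ (s - 1)) ^ (j + 2) * n ^ j := by
    have h1 : F ≤ (4:ℝ) ^ (j + 2) * (N:ℝ) ^ j := by
      rw [hF]; exact_mod_cast fac_aux j N hj
    refine (Real.rpow_le_rpow hF0.le h1 (by linarith)).trans (le_of_eq ?_)
    rw [Real.mul_rpow (by positivity) (by positivity), hn, ← Real.rpow_natCast, ← Real.rpow_natCast,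
      ← Real.rpow_natCast, ← Real.rpow_natCast, ← Real.rpow_mul (by norm_num),
      ← Real.rpow_mul (by positivity), ← Real.rpow_mul (by norm_num),
      ← Real.rpow_mul (by positivity)]
    congr 1 <;> congr 1 <;> ring
  have hDn : n ^ j * p ^ j ≤ D ^ (j + 2) := by
    calc n ^ j * p ^ j = (n * p) ^ j := by ring
      _ ≤ D ^ j := by gcongr; rw [hD]; linarith
      _ ≤ D ^ (j + 2) := pow_le_pow_right₀ hD1 (by omega)
  calc _ ≤ C₀ * A₀ ^ (j + 2) * F ^ s * ((ε * p / D) ^ (j + 2) / F) := by gcongr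
    _ = C₀ * A₀ ^ (j + 2) * F ^ (s - 1) * (ε * p / D) ^ (j + 2) := by
        rw [hFs]; field_simp
    _ ≤ C₀ * A₀ ^ (j + 2) * (((4:ℝ) ^ (s - 1)) ^ (j + 2) * n ^ j) * (ε * p / D) ^ (j + 2) := by
        gcongr
    _ = C₀ * (A₀ * (4:ℝ) ^ (s - 1) * ε) ^ (j + 2) * p ^ 2 * (n ^ j * p ^ j / D ^ (j + 2)) := by
        rw [div_pow]; ring
    _ ≤ C₀ * (A₀ * (4:ℝ) ^ (s - 1) * ε) ^ (j + 2) * p ^ 2 * 1 := by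
        gcongr
        exact div_le_one_of_le₀ hDn (by positivity)
    _ = _ := mul_one _

lemma JN_a {a : ℝ → ℝ} (ha : ContDiff ℝ ∞ a) (ha0 : ∀ x, 0 ≤ a x) {C₀ A₀ s ε p ρ x ξ : ℝ}
    (hC : 0 < C₀) (hA : 0 < A₀) (hs : 1 < s)
    (hG : ∀ (x : ℝ) (k : ℕ), |iteratedDeriv k a x| ≤ C₀ * A₀ ^ k * (k.factorial : ℝ) ^ s)
    (hε : 0 < ε) (hp : 0 < p) {k l N : ℕ} (hk : k ≤ N)
    (hε1 : (1 + C₀) * (A₀ * (4:ℝ) ^ (s - 1) * ε) ≤ 1 / 25)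
    (hε2 : (C₀ * A₀ ^ 2 * (2:ℝ) ^ s) * ε ^ 2 ≤ 1 / 100) :
    JN k l (ε * p / (1 + (N : ℝ) ^ (s - 1) * p)) ρ x ξ (fun x' _ => a x' - a x) ≤
      1 / 5 * (a x + p ^ 2) := by
  rw [JN_left (fun x' => a x' - a x), Finset.sum_range_succ']
  have hit : ∀ i, iteratedDeriv (i + 1) (fun x' => a x' - a x) x = iteratedDeriv (i + 1) a x := by
    intro i
    simp only [iteratedDeriv_succ', deriv_sub_const_fun]
  simp only [hit, iteratedDeriv_zero, sub_self, abs_zero, zero_mul, add_zero]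
  set r := ε * p / (1 + (N : ℝ) ^ (s - 1) * p) with hr
  have hr0 : 0 ≤ r := by positivity
  have hrε : r ≤ ε * p := div_le_self (by positivity) (by
    have : 0 ≤ (N : ℝ) ^ (s - 1) * p := by positivity
    linarith)
  have hax := ha0 x
  cases k with
  | zero => simp; positivity
  | succ k =>
    rw [Finset.sum_range_succ']
    set q := A₀ * (4:ℝ) ^ (s - 1) * ε with hq
    have hq0 : 0 < q := by positivity
    have hq1 : q ≤ 1 / 25 := by nlinarith
    have h1 : |iteratedDeriv (0 + 1) a x| * (r ^ (0 + 1) / (0 + 1).factorial) ≤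
        1 / 10 * a x + 1 / 10 * p ^ 2 := by
      have hg := glaeser ha ha0 (M := C₀ * A₀ ^ 2 * (2:ℝ) ^ s)
        (fun x => by simpa using hG x 2) x (c := 10 * r) (by positivity)
      simp only [zero_add, pow_one, Nat.factorial_one, Nat.cast_one, div_one]
      have : (C₀ * A₀ ^ 2 * (2:ℝ) ^ s) * r ^ 2 ≤ 1 / 100 * p ^ 2 := by
        calc _ ≤ (C₀ * A₀ ^ 2 * (2:ℝ) ^ s) * (ε * p) ^ 2 := by gcongr
          _ = (C₀ * A₀ ^ 2 * (2:ℝ) ^ s) * ε ^ 2 * p ^ 2 := by ring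
          _ ≤ _ := by gcongr
      nlinarith
    have h2 : ∑ j ∈ Finset.range k, |iteratedDeriv (j + 1 + 1) a x| *
        (r ^ (j + 1 + 1) / (j + 1 + 1).factorial) ≤ 1 / 10 * p ^ 2 := by
      have hb : ∀ j ∈ Finset.range k, |iteratedDeriv (j + 1 + 1) a x| *
        (r ^ (j + 1 + 1) / (j + 1 + 1).factorial) ≤ C₀ * q ^ 2 * p ^ 2 * (1 / 2) ^ j := by
        intro j hj
        refine (tail_term hC hA hs hε.le hp j N (by simp at hj; omega) (hG x (j + 2))).trans ?_
        rw [← hq]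
        calc C₀ * q ^ (j + 2) * p ^ 2 = C₀ * q ^ 2 * p ^ 2 * q ^ j := by ring
          _ ≤ _ := by gcongr; linarith
      refine (Finset.sum_le_sum hb).trans ?_
      rw [← Finset.mul_sum]
      have hg : ∑ i ∈ Finset.range k, ((1:ℝ) / 2) ^ i ≤ 2 := sum_geometric_two_le k
      have hCq : C₀ * q ^ 2 ≤ 1 / 20 := by
        have : C₀ * q ≤ 1 / 25 := by nlinarith
        nlinarith
      calc _ ≤ C₀ * q ^ 2 * p ^ 2 * 2 := by gcongr
        _ ≤ 1 / 20 * p ^ 2 * 2 := by gcongr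
        _ = _ := by ring
    linarith

lemma br_rpow {δ μ ξ : ℝ} (hμ : 0 < μ) :
    br μ ξ ^ (-(2 * δ)) = ((μ⁻¹ ^ 2 + ξ ^ 2) ^ δ)⁻¹ := by
  have hu : 0 < μ⁻¹ ^ 2 + ξ ^ 2 := by positivity
  rw [br, Real.sqrt_eq_rpow, ← Real.rpow_mul hu.le, ← Real.rpow_neg hu.le]
  congr 1; ring

lemma Lam_eq {b a : ℝ → ℝ} {T δ μ t x ξ : ℝ} (hμ : 0 < μ) :
    Lam b a T δ μ t x ξ = ∫ σ in (0:ℝ)..t, |derivWithin b (Icc 0 T) σ| *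
      GF 0 (b σ) (1 + a x * (μ⁻¹ ^ 2 + ξ ^ 2) ^ δ) := by
  unfold Lam phi
  rw [br_rpow hμ]
  have hu : 0 < μ⁻¹ ^ 2 + ξ ^ 2 := by positivity
  have hW : 0 < (μ⁻¹ ^ 2 + ξ ^ 2) ^ δ := Real.rpow_pos_of_pos hu _
  generalize (μ⁻¹ ^ 2 + ξ ^ 2) ^ δ = W at *
  congr 1
  ext σ
  simp only [GF]
  rw [mul_div_assoc]
  congr 1
  have e1 : a x + W⁻¹ = W⁻¹ * (1 + a x * W) := by field_simp; ring
  rw [e1, show b σ * (W⁻¹ * (1 + a x * W)) + W⁻¹ = W⁻¹ * (b σ * (1 + a x * W) + 1) by ring,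
    mul_div_mul_left _ _ (inv_ne_zero hW.ne')]

lemma JN_psi {a : ℝ → ℝ} (ha : ContDiff ℝ ∞ a) (ha0 : ∀ x, 0 ≤ a x) {C₀ A₀ s ε x ξ μ δ : ℝ}
    (hC : 0 < C₀) (hA : 0 < A₀) (hs : 1 < s)
    (hG : ∀ (x : ℝ) (k : ℕ), |iteratedDeriv k a x| ≤ C₀ * A₀ ^ k * (k.factorial : ℝ) ^ s)
    (hε : 0 < ε) {k l N : ℕ} (hk : k ≤ N) (hμ : 0 < μ) (hδ0 : 0 ≤ δ) (hδ1 : δ ≤ 1)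
    (hε0 : ε ≤ 1 / 25)
    (hε1 : (1 + C₀) * (A₀ * (4:ℝ) ^ (s - 1) * ε) ≤ 1 / 25)
    (hε2 : (C₀ * A₀ ^ 2 * (2:ℝ) ^ s) * ε ^ 2 ≤ 1 / 100) :
    JN k l (ε * br μ ξ ^ (-δ) / (1 + (N : ℝ) ^ (s - 1) * br μ ξ ^ (-δ))) (ε * br μ ξ) x ξ
      (fun x' ξ' => (1 + a x' * (μ⁻¹ ^ 2 + ξ' ^ 2) ^ δ) - (1 + a x * (μ⁻¹ ^ 2 + ξ ^ 2) ^ δ)) ≤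
      1 / 2 * (1 + a x * (μ⁻¹ ^ 2 + ξ ^ 2) ^ δ) := by
  have hc : 0 < μ⁻¹ ^ 2 := by positivity
  have hw : 0 < br μ ξ := Real.sqrt_pos.2 (by positivity)
  have hp : 0 < br μ ξ ^ (-δ) := Real.rpow_pos_of_pos hw _
  have hp2 : (br μ ξ ^ (-δ)) ^ 2 = ((μ⁻¹ ^ 2 + ξ ^ 2) ^ δ)⁻¹ := by
    rw [← br_rpow hμ, ← Real.rpow_natCast, ← Real.rpow_mul hw.le]
    congr 1; push_cast; ring
  set p := br μ ξ ^ (-δ) with hpdef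
  set r := ε * p / (1 + (N : ℝ) ^ (s - 1) * p) with hr
  have hr0 : 0 ≤ r := by positivity
  have hρ : 0 ≤ ε * br μ ξ := by positivity
  have h1 : JN k l r (ε * br μ ξ) x ξ (fun x' _ => a x' - a x) ≤ 1 / 5 * (a x + p ^ 2) :=
    JN_a ha ha0 hC hA hs hG hε hp hk hε1 hε2
  have h2 : JN k l r (ε * br μ ξ) x ξ
      (fun _ ξ' => (μ⁻¹ ^ 2 + ξ' ^ 2) ^ δ - (μ⁻¹ ^ 2 + ξ ^ 2) ^ δ) ≤
      1 / 5 * (μ⁻¹ ^ 2 + ξ ^ 2) ^ δ := JN_W hr0 hε.le hε0 hc hδ0 hδ1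
  rw [hp2] at h1
  have hW : 0 < (μ⁻¹ ^ 2 + ξ ^ 2) ^ δ := Real.rpow_pos_of_pos (by positivity) _
  have sW : SM (fun _ ξ' => (μ⁻¹ ^ 2 + ξ' ^ 2) ^ δ) := by
    have : SM (fun _ ξ' => μ⁻¹ ^ 2 + ξ' ^ 2) := by unfold SM; fun_prop
    exact ContDiff.rpow_const_of_ne this (fun q => by positivity)
  have sa : SM (fun x' _ => a x') := ha.comp contDiff_fst
  set W := (μ⁻¹ ^ 2 + ξ ^ 2) ^ δ with hWdef
  have sWs := sW.sub (SM.const W)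
  have sas := sa.sub (SM.const (a x))
  have e : (fun x' ξ' => (1 + a x' * (μ⁻¹ ^ 2 + ξ' ^ 2) ^ δ) - (1 + a x * W)) =
      fun x' ξ' => (a x' - a x) * ((μ⁻¹ ^ 2 + ξ' ^ 2) ^ δ) +
        a x * ((μ⁻¹ ^ 2 + ξ' ^ 2) ^ δ - W) := by
    ext x' ξ'; ring
  have eW : (fun (_ : ℝ) ξ' => (μ⁻¹ ^ 2 + ξ' ^ 2) ^ δ) =
      fun _ ξ' => ((μ⁻¹ ^ 2 + ξ' ^ 2) ^ δ - W) + W := by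
    ext; ring
  have h3 : JN k l r (ε * br μ ξ) x ξ (fun _ ξ' => (μ⁻¹ ^ 2 + ξ' ^ 2) ^ δ) ≤ 6 / 5 * W := by
    rw [eW]
    refine (JN_add hr0 hρ sWs (SM.const W)).trans ?_
    rw [JN_const, abs_of_pos hW]
    linarith
  rw [e]
  refine (JN_add hr0 hρ (sas.mul sW) ((SM.const (a x)).mul sWs)).trans ?_
  rw [JN_const_mul (a x) (fun _ ξ' => (μ⁻¹ ^ 2 + ξ' ^ 2) ^ δ - W), abs_of_nonneg (ha0 x)]
  have hax := ha0 x
  calc _ ≤ (1 / 5 * (a x + W⁻¹)) * (6 / 5 * W) + a x * (1 / 5 * W) := by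
        refine add_le_add ((JN_mul hr0 hρ sas sW).trans ?_) (mul_le_mul_of_nonneg_left h2 hax)
        exact mul_le_mul h1 h3 (JN_nonneg hr0 hρ _) (by positivity)
    _ = 11 / 25 * (a x * W) + 6 / 25 := by field_simp; ring
    _ ≤ _ := by
        have : 0 ≤ a x * W := by positivity
        linarith

theorem stmt8 (T : ℝ) (hT : 0 < T)
    (b : ℝ → ℝ) (hb : ContDiffOn ℝ 1 b (Icc 0 T)) (hb0 : ∀ t ∈ Icc (0:ℝ) T, 0 ≤ b t)
    (s δ : ℝ) (hs : 1 < s) (hδ0 : 0 ≤ δ) (hδ1 : δ < 1)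
    (a : ℝ → ℝ) (ha : Gevrey s a) (ha0 : ∀ x, 0 ≤ a x) :
    ∃ A C : ℝ, 0 < A ∧ 0 < C ∧
      ∀ (k l : ℕ) (μ t x ξ : ℝ), 0 < μ → μ ≤ 1 → t ∈ Icc (0:ℝ) T →
        |pdXxi k l (fun x' ξ' => Lam b a T δ μ t x' ξ') x ξ| ≤
          C * A ^ (k + l) * ((k + l).factorial : ℝ) *
            (1 + ((k + l : ℕ) : ℝ) ^ (s - 1) * br μ ξ ^ (-δ)) ^ (k + l) *
            Lam b a T δ μ t x ξ * br μ ξ ^ (-(l : ℝ) + δ * (k : ℝ)) := by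
  obtain ⟨has, C₀, A₀, hC, hA, hG⟩ := ha
  obtain ⟨ε, hε, hε0, hε1, hε2⟩ : ∃ ε : ℝ, 0 < ε ∧ ε ≤ 1 / 25 ∧
      (1 + C₀) * (A₀ * (4:ℝ) ^ (s - 1) * ε) ≤ 1 / 25 ∧
      (C₀ * A₀ ^ 2 * (2:ℝ) ^ s) * ε ^ 2 ≤ 1 / 100 := by
    set B := (1 + C₀) * (A₀ * (4:ℝ) ^ (s - 1)) with hB
    set M := C₀ * A₀ ^ 2 * (2:ℝ) ^ s with hM
    have hB0 : 0 < B := by positivity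
    have hM0 : 0 < M := by positivity
    have hS : 0 < 1 + B + M := by positivity
    refine ⟨1 / (25 * (1 + B + M)), by positivity, ?_, ?_, ?_⟩
    · rw [div_le_div_iff₀ (by positivity) (by norm_num)]; linarith
    · rw [← mul_assoc, ← hB, mul_one_div, div_le_div_iff₀ (by positivity) (by norm_num)]; linarith
    · rw [div_pow, mul_div_assoc', div_le_div_iff₀ (by positivity) (by norm_num)]
      nlinarith [mul_pos hB0 hM0]
  refine ⟨1 / ε, 2, by positivity, by norm_num, ?_⟩
  intro k l μ t x ξ hμ hμ1 ht
  have hbc : ContinuousOn b (Icc 0 T) := hb.continuousOn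
  have hβc : ContinuousOn (fun σ => |derivWithin b (Icc 0 T) σ|) (Icc 0 T) :=
    (hb.continuousOn_derivWithin (uniqueDiffOn_Icc hT) le_rfl).abs
  have hw : 0 < br μ ξ := Real.sqrt_pos.2 (by positivity)
  have hp : 0 < br μ ξ ^ (-δ) := Real.rpow_pos_of_pos hw _
  have hJ := JN_psi (x := x) (ξ := ξ) (l := l) has ha0 hC hA hs hG hε (Nat.le_add_right k l)
    hμ hδ0 hδ1.le hε0 hε1 hε2
  have sW : SM (fun _ ξ' => (μ⁻¹ ^ 2 + ξ' ^ 2) ^ δ) := by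
    have : SM (fun _ ξ' => μ⁻¹ ^ 2 + ξ' ^ 2) := by unfold SM; fun_prop
    exact ContDiff.rpow_const_of_ne this (fun q => by positivity)
  have sa : SM (fun x' _ => a x') := has.comp contDiff_fst
  have sψ := (SM.const 1).add (sa.mul sW)
  have hψ : ∀ x ξ : ℝ, 0 < 1 + a x * (μ⁻¹ ^ 2 + ξ ^ 2) ^ δ := fun x ξ => by
    have := ha0 x
    positivity
  simp only [Lam_eq hμ]
  set D := 1 + ((k + l : ℕ) : ℝ) ^ (s - 1) * br μ ξ ^ (-δ) with hD
  have hD1 : 1 ≤ D := by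
    have : 0 ≤ ((k + l : ℕ) : ℝ) ^ (s - 1) * br μ ξ ^ (-δ) := by positivity
    linarith
  have hD0 : 0 < D := by linarith
  set r := ε * br μ ξ ^ (-δ) / D with hr
  have hr0 : 0 < r := by positivity
  set ρ := ε * br μ ξ with hρdef
  have hρ : 0 < ρ := by positivity
  have hch := int_chain ht hbc hb0 hβc
  have hbd := fun m => int_bound ht hbc hb0 hβc (fun _ => abs_nonneg _) m (hψ x ξ)
  have hcomp := JN_comp hr0.le hρ.le sψ hψ hch _ (1 / 2) hbd le_rfl hJ
  set L := ∫ σ in (0:ℝ)..t, |derivWithin b (Icc 0 T) σ| *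
      GF 0 (b σ) (1 + a x * (μ⁻¹ ^ 2 + ξ ^ 2) ^ δ) with hL
  have hL0 : 0 ≤ L := by
    have := hbd 0
    simp only [pow_zero, mul_one, Nat.factorial_zero, Nat.cast_one, one_mul] at this
    exact (abs_nonneg _).trans this
  set Φ : ℝ → ℝ → ℝ := fun x' ξ' => ∫ σ in (0:ℝ)..t, |derivWithin b (Icc 0 T) σ| *
      GF 0 (b σ) (1 + a x' * (μ⁻¹ ^ 2 + ξ' ^ 2) ^ δ) with hΦ
  have sΦ : SM Φ := hch.comp sψ hψ
  have hJΦ : JN k l r ρ x ξ Φ ≤ 2 * L := by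
    have e : Φ = fun x' ξ' => (Φ x' ξ' - L) + L := by ext; ring
    rw [e]
    refine (JN_add hr0.le hρ.le (sΦ.sub (SM.const L)) (SM.const L)).trans ?_
    rw [JN_const, abs_of_nonneg hL0]
    have : JN k l r ρ x ξ (fun x' ξ' => Φ x' ξ' - L) ≤ 2 * (1 / 2) * L := hcomp
    linarith
  have hfin := (JN_single hr0.le hρ.le Φ).trans hJΦ
  have hkf : (0:ℝ) < k.factorial := by exact_mod_cast Nat.factorial_pos _
  have hlf : (0:ℝ) < l.factorial := by exact_mod_cast Nat.factorial_pos _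
  have h1 : |pdXxi k l Φ x ξ| ≤ 2 * L * (k.factorial * l.factorial) / (r ^ k * ρ ^ l) := by
    rw [le_div_iff₀ (by positivity)]
    calc _ = (|pdXxi k l Φ x ξ| * (r ^ k / k.factorial) * (ρ ^ l / l.factorial)) *
          (k.factorial * l.factorial) := by field_simp
      _ ≤ _ := by gcongr
  refine h1.trans ?_
  have hfac : (k.factorial * l.factorial : ℝ) ≤ (k + l).factorial := by
    exact_mod_cast Nat.le_of_dvd (Nat.factorial_pos _) (Nat.factorial_mul_factorial_dvd_factorial_add k l)
  have hpow : br μ ξ ^ (-(l : ℝ) + δ * (k : ℝ)) = 1 / ((br μ ξ ^ (-δ)) ^ k * br μ ξ ^ l) := by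
    rw [Real.rpow_add hw, Real.rpow_neg hw.le, Real.rpow_natCast, Real.rpow_neg hw.le,
      Real.rpow_mul hw.le, Real.rpow_natCast]
    have := Real.rpow_pos_of_pos hw δ
    rw [inv_pow]
    field_simp
  have heq : 1 / (r ^ k * ρ ^ l) =
      (1 / ε) ^ (k + l) * D ^ k * br μ ξ ^ (-(l : ℝ) + δ * (k : ℝ)) := by
    rw [hpow, hr, hρdef, div_pow, mul_pow, mul_pow, pow_add, one_div_pow, one_div_pow]
    field_simp
  have hX : 0 < br μ ξ ^ (-(l : ℝ) + δ * (k : ℝ)) := Real.rpow_pos_of_pos hw _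
  calc _ = 2 * L * (k.factorial * l.factorial) * (1 / (r ^ k * ρ ^ l)) := by rw [mul_one_div]
    _ = 2 * L * (k.factorial * l.factorial) *
        ((1 / ε) ^ (k + l) * D ^ k * br μ ξ ^ (-(l : ℝ) + δ * (k : ℝ))) := by rw [heq]
    _ ≤ 2 * L * (k + l).factorial *
        ((1 / ε) ^ (k + l) * D ^ (k + l) * br μ ξ ^ (-(l : ℝ) + δ * (k : ℝ))) := by
        gcongr
        omega
    _ = _ := by ring
end
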